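/- Let B_1 denote the open unit disc in ℝ², let γ > 0, let K ∈ L^∞(B_1) be nonnegative, and let u ∈ C²(B_1 \ {0}) solve −Δu = |x|^{−γ} K(x) e^u in B_1 \ {0} with ∫_{B_1 \ {0}} |x|^{−γ} e^{u(x)} dx < ∞. Then there exist a constant α > −2, an exponent σ ∈ (0,1), and a function φ that is σ-Hölder continuous on a neighborhood of the origin, such that u(x) = (α + γ) ln|x| + φ(x) for all x ≠ 0 in that neighborhood. -/

import Mathlib

open MeasureTheory Metric Real Set
open scoped ENNReal NNReal

noncomputable section

/-- First-order partial derivative in direction `i`. -/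
def pderiv1 {n : ℕ} (i : Fin n) (f : EuclideanSpace ℝ (Fin n) → ℝ) :
    EuclideanSpace ℝ (Fin n) → ℝ :=
  fun x => fderiv ℝ f x (EuclideanSpace.single i 1)

/-- The Laplacian `Δf = ∑ ∂²f/∂xᵢ²`. -/
def lap {n : ℕ} (f : EuclideanSpace ℝ (Fin n) → ℝ) : EuclideanSpace ℝ (Fin n) → ℝ :=
  fun x => ∑ i, pderiv1 i (pderiv1 i f) x

/-- The negative Laplacian `-Δ`. -/
def nlap {n : ℕ} (f : EuclideanSpace ℝ (Fin n) → ℝ) : EuclideanSpace ℝ (Fin n) → ℝ :=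
  fun x => -(lap f x)

/-- `(-Δ)^m`, the m-th iterate of the negative Laplacian. -/
def nlapIter {n : ℕ} (m : ℕ) (f : EuclideanSpace ℝ (Fin n) → ℝ) :
    EuclideanSpace ℝ (Fin n) → ℝ :=
  nlap^[m] f

/-- `D^β`, the mixed partial derivative associated to a multi-index `β`. -/
def mderiv {n : ℕ} (β : Fin n → ℕ) (f : EuclideanSpace ℝ (Fin n) → ℝ) :
    EuclideanSpace ℝ (Fin n) → ℝ :=
  ((List.finRange n).foldr (fun i F => F ∘ (pderiv1 i)^[β i]) id) f

/-- The finset of multi-indices `β` with `|β| ≤ s`. -/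
def degLE (n s : ℕ) : Finset (Fin n → ℕ) :=
  (Fintype.piFinset fun _ : Fin n => Finset.range (s+1)).filter fun β => ∑ i, β i ≤ s

/-- The finset of multi-indices `β` with `|β| < s` (i.e. `|β| ≤ s - 1`; empty for `s = 0`). -/
def degLT (n s : ℕ) : Finset (Fin n → ℕ) :=
  (Fintype.piFinset fun _ : Fin n => Finset.range s).filter fun β => ∑ i, β i < s

/-- Fundamental-solution profile of `(-Δ)^m` on `ℝⁿ`:
`c‖x‖^{2m-n}` for `n > 2m` and `c ln(5/‖x‖)` for `n = 2m`. -/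
def fundSol (m n : ℕ) (c : ℝ) : EuclideanSpace ℝ (Fin n) → ℝ :=
  fun x => if n = 2*m then c * Real.log (5 / ‖x‖) else c * ‖x‖ ^ ((2*m : ℤ) - n)

/-- `ψ(x,y) = φ(x-y) - ∑_{|β| ≤ s-1} ((-y)^β/β!) D^β φ(x)`. -/
def psiFun (m n s : ℕ) (c : ℝ) (x y : EuclideanSpace ℝ (Fin n)) : ℝ :=
  fundSol m n c (x - y) -
    ∑ β ∈ degLT n s,
      ((∏ i, (-(y i)) ^ β i) / ∏ i, ((β i).factorial : ℝ)) * mderiv β (fundSol m n c) x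

/-- `N(x) = ∫_{|y| ≤ 1} ψ(x,y) f(y) dy`. -/
def NFun (m n s : ℕ) (c : ℝ) (f : EuclideanSpace ℝ (Fin n) → ℝ)
    (x : EuclideanSpace ℝ (Fin n)) : ℝ :=
  ∫ y in closedBall (0 : EuclideanSpace ℝ (Fin n)) 1, psiFun m n s c x y * f y

theorem Complex.integrableOn_polarCoord_symm {F : ℂ → ℝ} (hF : Integrable F) :
    IntegrableOn (fun p : ℝ × ℝ => p.1 * F (Complex.polarCoord.symm p)) polarCoord.target := by
  have h1 : Integrable (fun q : ℝ × ℝ => F (Complex.measurableEquivRealProd.symm q)) :=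
    (Complex.volume_preserving_equiv_real_prod.symm).integrable_comp_of_integrable hF
  have h2 := (integrableOn_image_iff_integrableOn_abs_det_fderiv_smul volume
    (measurableSet_Ioi.prod measurableSet_Ioo : MeasurableSet polarCoord.target)
    (fun p _ ↦ (hasFDerivAt_polarCoord_symm p).hasFDerivWithinAt)
    polarCoord.symm.injOn _).1 h1.integrableOn
  refine h2.congr_fun (fun p hp => ?_) polarCoord.open_target.measurableSet
  simp only [det_fderivPolarCoordSymm, smul_eq_mul,
    Complex.measurableEquivRealProd_symm_polarCoord_symm_apply]
  rw [abs_of_pos hp.1]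

theorem circleAverage_eq_setIntegral_Ioo (F : ℂ → ℝ) (c : ℂ) (r : ℝ) :
    ∫ θ in Ioo (-π) π, F (c + Complex.polarCoord.symm (r, θ)) = 2 * π * circleAverage F c r := by
  have h : 2 * π + -π = π := by ring
  rw [circleAverage_eq_integral_add (-π), intervalIntegral.integral_comp_add_right
    (fun θ => F (circleMap c r θ)), h, zero_add,
    intervalIntegral.integral_of_le (by linarith [pi_pos]), integral_Ioc_eq_integral_Ioo,
    smul_eq_mul, ← mul_assoc, mul_inv_cancel₀ (by positivity), one_mul]
  simp [circleMap, Complex.exp_mul_I]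

theorem integrableOn_circleAverage {F : ℂ → ℝ} (hF : Integrable F) (c : ℂ) :
    IntegrableOn (fun r => 2 * π * r * circleAverage F c r) (Ioi 0) := by
  have h1 := Complex.integrableOn_polarCoord_symm (hF.comp_add_left c)
  have h2 : Integrable (fun p : ℝ × ℝ => p.1 * F (c + Complex.polarCoord.symm p))
    ((volume.restrict (Ioi 0)).prod (volume.restrict (Ioo (-π) π))) := by
    rw [Measure.prod_restrict]; exact h1
  refine h2.integral_prod_left.congr (ae_of_all _ fun r => ?_)
  simp only
  rw [integral_const_mul, circleAverage_eq_setIntegral_Ioo]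
  ring

theorem integral_eq_integral_circleAverage {F : ℂ → ℝ} (hF : Integrable F) (c : ℂ) :
    ∫ z, F z = ∫ r in Ioi 0, 2 * π * r * circleAverage F c r := by
  have h1 := Complex.integrableOn_polarCoord_symm (hF.comp_add_left c)
  have h3 : ∫ z, F z = ∫ z, F (c + z) := (integral_add_left_eq_self F c).symm
  rw [h3, ← Complex.integral_comp_polarCoord_symm]
  have h4 : polarCoord.target = Ioi (0:ℝ) ×ˢ Ioo (-π) π := rfl
  rw [h4] at h1 ⊢
  rw [Measure.volume_eq_prod] at h1 ⊢
  rw [setIntegral_prod _ (by simpa using h1)]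
  refine setIntegral_congr_fun measurableSet_Ioi fun r hr => ?_
  simp only [smul_eq_mul]
  rw [integral_const_mul, circleAverage_eq_setIntegral_Ioo]
  ring

theorem circleAverage_radial_mul (k : ℝ → ℝ) (F : ℂ → ℝ) (c : ℂ) {r : ℝ} (hr : 0 ≤ r) :
    circleAverage (fun z => k ‖z - c‖ * F z) c r = k r * circleAverage F c r := by
  rw [← smul_eq_mul (k r), ← circleAverage_fun_smul]
  refine circleAverage_congr_sphere fun z hz => ?_
  rw [mem_sphere, dist_eq_norm, abs_of_nonneg hr] at hz
  simp [hz]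

/-- Integration against a radial kernel of a function with constant circle averages. -/
theorem integral_radial_mul_eq {F : ℂ → ℝ} {k : ℝ → ℝ} {c : ℂ} {m : ℝ}
    (hF : Integrable fun z => k ‖z - c‖ * F z) (hk : Integrable fun z : ℂ => k ‖z - c‖)
    (h : ∀ r > 0, k r ≠ 0 → circleAverage F c r = m) :
    ∫ z, k ‖z - c‖ * F z = m * ∫ z, k ‖z - c‖ := by
  have hk1 : (fun z : ℂ => k ‖z - c‖) = fun z => k ‖z - c‖ * (fun _ => (1:ℝ)) z := by simp
  rw [integral_eq_integral_circleAverage hF c, integral_eq_integral_circleAverage hk c,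
    ← integral_const_mul]
  refine setIntegral_congr_fun measurableSet_Ioi fun r hr => ?_
  rw [hk1, circleAverage_radial_mul _ _ _ (le_of_lt hr), circleAverage_radial_mul _ _ _ (le_of_lt hr),
    circleAverage_const]
  by_cases h0 : k r = 0
  · simp [h0]
  · rw [h r hr h0]; ring

open scoped Topology in
theorem hasDerivAt_intervalIntegral_of_continuousOn {G G' : ℝ → ℝ → ℝ} {a b T : ℝ}
    (hG : ContinuousOn (Function.uncurry G) (Ioo a b ×ˢ univ))
    (hG' : ContinuousOn (Function.uncurry G') (Ioo a b ×ˢ univ))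
    (hd : ∀ r ∈ Ioo a b, ∀ θ, HasDerivAt (fun s => G s θ) (G' r θ) r) {r : ℝ} (hr : r ∈ Ioo a b) :
    HasDerivAt (fun s => ∫ θ in (0:ℝ)..T, G s θ) (∫ θ in (0:ℝ)..T, G' r θ) r := by
  have hslice : ∀ {H : ℝ → ℝ → ℝ}, ContinuousOn (Function.uncurry H) (Ioo a b ×ˢ univ) →
      ∀ s ∈ Ioo a b, Continuous (H s) := fun {H} hH s hs =>
    continuousOn_univ.1 (hH.comp (f := fun θ => (s, θ)) (by fun_prop)
      fun θ _ => ⟨hs, mem_univ _⟩)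
  obtain ⟨δ, hδ, hsub⟩ := nhds_basis_closedBall.mem_iff.1 (isOpen_Ioo.mem_nhds hr)
  have hcomp : IsCompact (closedBall r δ ×ˢ uIcc 0 T) :=
    (isCompact_closedBall r δ).prod isCompact_uIcc
  obtain ⟨M, hM⟩ := hcomp.exists_bound_of_continuousOn
    (hG'.mono (prod_mono hsub (subset_univ _)))
  refine (intervalIntegral.hasDerivAt_integral_of_dominated_loc_of_deriv_le
    (F := G) (F' := G') (bound := fun _ => M) (closedBall_mem_nhds r hδ) ?_ ?_ ?_ ?_ ?_ ?_).2
  · filter_upwards [isOpen_Ioo.mem_nhds hr] with s hs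
    exact (hslice hG s hs).aestronglyMeasurable
  · exact (hslice hG r hr).intervalIntegrable _ _
  · exact (hslice hG' r hr).aestronglyMeasurable
  · exact ae_of_all _ fun θ hθ s hs => hM (s, θ) ⟨hs, uIoc_subset_uIcc hθ⟩
  · simp
  · exact ae_of_all _ fun θ hθ s hs => hd s (hsub hs) θ

theorem continuous_circleMap_uncurry (c : ℂ) :
    Continuous (fun p : ℝ × ℝ => circleMap c p.1 p.2) := by
  unfold circleMap; fun_prop

theorem circleMap_mem_of_sphere_subset {U : Set ℂ} {c : ℂ} {a b : ℝ} (ha : 0 ≤ a)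
    (hU : ∀ r ∈ Ioo a b, sphere c r ⊆ U) {r : ℝ} (hr : r ∈ Ioo a b) (θ : ℝ) :
    circleMap c r θ ∈ U :=
  hU r hr (circleMap_mem_sphere c (ha.trans hr.1.le) θ)

theorem hasDerivAt_circleAverage {U : Set ℂ} (hUo : IsOpen U) {w : ℂ → ℝ}
    (hw : ContDiffOn ℝ 1 w U) {c : ℂ} {a b : ℝ} (ha : 0 ≤ a)
    (hU : ∀ r ∈ Ioo a b, sphere c r ⊆ U) {r : ℝ} (hr : r ∈ Ioo a b) :
    HasDerivAt (circleAverage w c)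
      (r⁻¹ * circleAverage (fun z => fderiv ℝ w z (z - c)) c r) r := by
  have hm := continuous_circleMap_uncurry c
  have hmaps : MapsTo (fun p : ℝ × ℝ => circleMap c p.1 p.2) (Ioo a b ×ˢ univ) U :=
    fun p hp => circleMap_mem_of_sphere_subset ha hU hp.1 p.2
  have hD : ContinuousOn (fderiv ℝ w) U := hw.continuousOn_fderiv_of_isOpen hUo le_rfl
  have hD' : ContinuousOn (fun p : ℝ × ℝ => fderiv ℝ w (circleMap c p.1 p.2)) (Ioo a b ×ˢ univ) :=
    hD.comp hm.continuousOn hmaps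
  have key := hasDerivAt_intervalIntegral_of_continuousOn (T := 2 * π) (a := a) (b := b)
    (G := fun s θ => w (circleMap c s θ))
    (G' := fun s θ => fderiv ℝ w (circleMap c s θ) (Complex.exp (θ * Complex.I)))
    (hw.continuousOn.comp hm.continuousOn hmaps)
    (hD'.clm_apply (by fun_prop)) ?_ hr
  · have h2 := key.const_mul (2 * π)⁻¹
    have hr0 : r ≠ 0 := (ha.trans_lt hr.1).ne'
    have hfun : circleAverage w c =
        fun s => (2 * π)⁻¹ * ∫ θ in (0:ℝ)..2 * π, w (circleMap c s θ) := by
      ext s; simp only [circleAverage_def, smul_eq_mul]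
    rw [hfun]
    refine h2.congr_deriv (Eq.symm ?_)
    rw [circleAverage_def, smul_eq_mul, mul_left_comm, ← intervalIntegral.integral_const_mul]
    congr 2
    ext θ
    simp only [circleMap, add_sub_cancel_left]
    rw [← Complex.real_smul, map_smul, smul_eq_mul, inv_mul_cancel_left₀ hr0]
  · intro s hs θ
    have h1 : HasFDerivAt w (fderiv ℝ w (circleMap c s θ)) (circleMap c s θ) :=
      ((hw.differentiableOn one_ne_zero).differentiableAt
        (hUo.mem_nhds (hmaps (x := (s, θ)) ⟨hs, mem_univ _⟩))).hasFDerivAt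
    have h2 : HasDerivAt (fun s : ℝ => circleMap c s θ) (Complex.exp (θ * Complex.I)) s := by
      simpa [circleMap] using
        ((Complex.ofRealCLM.hasDerivAt (x := s)).mul_const (Complex.exp (θ * Complex.I))).const_add c
    exact h1.comp_hasDerivAt s h2

theorem circleAverage_fderiv_angular {U : Set ℂ} (hUo : IsOpen U) {w : ℂ → ℝ}
    (hw : ContDiffOn ℝ 1 w U) {c : ℂ} {r : ℝ} (hr : 0 ≤ r) (hU : sphere c r ⊆ U) :
    circleAverage (fun z => fderiv ℝ w z (Complex.I * (z - c))) c r = 0 := by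
  have hmaps : ∀ θ, circleMap c r θ ∈ U := fun θ => hU (circleMap_mem_sphere c hr θ)
  have hD : ContinuousOn (fderiv ℝ w) U := hw.continuousOn_fderiv_of_isOpen hUo le_rfl
  have hder : ∀ θ : ℝ, HasDerivAt (fun θ => w (circleMap c r θ))
      (fderiv ℝ w (circleMap c r θ) (Complex.I * (circleMap c r θ - c))) θ := by
    intro θ
    have h1 : HasFDerivAt w (fderiv ℝ w (circleMap c r θ)) (circleMap c r θ) :=
      ((hw.differentiableOn one_ne_zero).differentiableAt
        (hUo.mem_nhds (hmaps θ))).hasFDerivAt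
    have h2 := hasDerivAt_circleMap c r θ
    have h3 := h1.comp_hasDerivAt θ h2
    rw [circleMap_sub_center, mul_comm]
    exact h3
  have hcont : Continuous fun θ => fderiv ℝ w (circleMap c r θ)
      (Complex.I * (circleMap c r θ - c)) := by
    have : Continuous fun θ => fderiv ℝ w (circleMap c r θ) :=
      hD.comp_continuous (continuous_circleMap c r) hmaps
    exact this.clm_apply (by fun_prop)
  rw [circleAverage, intervalIntegral.integral_eq_sub_of_hasDerivAt (fun θ _ => hder θ)
    (hcont.intervalIntegrable _ _)]
  have : circleMap c r (2 * π) = circleMap c r 0 := by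
    simpa using periodic_circleMap c r 0
  simp [this]

open Laplacian InnerProductSpace in
theorem hasDerivAt_circleAverage_radial {U : Set ℂ} (hUo : IsOpen U) {w : ℂ → ℝ}
    (hw : ContDiffOn ℝ 2 w U) {c : ℂ} {a b : ℝ} (ha : 0 ≤ a)
    (hU : ∀ r ∈ Ioo a b, sphere c r ⊆ U) {r : ℝ} (hr : r ∈ Ioo a b) :
    HasDerivAt (circleAverage (fun z => fderiv ℝ w z (z - c)) c)
      (r * circleAverage (Δ w) c r) r := by
  have hr0 : 0 < r := ha.trans_lt hr.1
  have hD : ContDiffOn ℝ 1 (fderiv ℝ w) U := hw.fderiv_of_isOpen hUo (by norm_num)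
  have hB : ContDiffOn ℝ 1 (fun z => fderiv ℝ w z (z - c)) U :=
    hD.clm_apply (by fun_prop)
  have hV : ContDiffOn ℝ 1 (fun z => fderiv ℝ w z (Complex.I * (z - c))) U :=
    hD.clm_apply (by fun_prop)
  have h1 := hasDerivAt_circleAverage hUo hB ha hU hr
  have h2 := circleAverage_fderiv_angular hUo hV hr0.le (hU r hr)
  have hcB : ContinuousOn (fun z => fderiv ℝ (fun z => fderiv ℝ w z (z - c)) z (z - c)) U :=
    (hB.continuousOn_fderiv_of_isOpen hUo le_rfl).clm_apply (by fun_prop)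
  have hcV : ContinuousOn (fun z => fderiv ℝ (fun z => fderiv ℝ w z (Complex.I * (z - c))) z
      (Complex.I * (z - c))) U :=
    (hV.continuousOn_fderiv_of_isOpen hUo le_rfl).clm_apply (by fun_prop)
  have hiB := (hcB.mono (hU r hr)).circleIntegrable hr0.le
  have hiV := (hcV.mono (hU r hr)).circleIntegrable hr0.le
  convert h1 using 1
  rw [← add_zero (circleAverage (fun z => fderiv ℝ (fun z => fderiv ℝ w z (z - c)) z (z - c)) c r),
    ← h2, ← circleAverage_fun_add hiB hiV]
  have h3 : r * circleAverage (Δ w) c r = r⁻¹ * (r ^ 2 * circleAverage (Δ w) c r) := by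
    field_simp
  rw [h3, ← smul_eq_mul (r ^ 2), ← circleAverage_fun_smul]
  congr 1
  refine circleAverage_congr_sphere fun z hz => ?_
  rw [abs_of_pos hr0] at hz
  have hzU : z ∈ U := hU r hr hz
  have hDz : HasFDerivAt (fderiv ℝ w) (fderiv ℝ (fderiv ℝ w) z) z :=
    ((hD.differentiableOn one_ne_zero).differentiableAt (hUo.mem_nhds hzU)).hasFDerivAt
  have e1 := hDz.clm_apply ((hasFDerivAt_id z).sub_const c)
  have e2 := hDz.clm_apply (((hasFDerivAt_id z).sub_const c).const_mul Complex.I)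
  simp only [id] at e1 e2
  rw [e1.fderiv, e2.fderiv, laplacian_eq_iteratedFDeriv_complexPlane]
  simp only [iteratedFDeriv_two_apply, smul_eq_mul]
  have hn : r ^ 2 = (z - c).re ^ 2 + (z - c).im ^ 2 := by
    rw [mem_sphere, dist_eq_norm] at hz
    rw [← hz, Complex.sq_norm, Complex.normSq_apply]; ring
  set p := z - c with hp
  have hpe : p = p.re • (1:ℂ) + p.im • Complex.I := by
    apply Complex.ext <;> simp
  have hip : Complex.I * p = (-p.im) • (1:ℂ) + p.re • Complex.I := by
    apply Complex.ext <;> simp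
  have hiip : Complex.I * (Complex.I * p) = - p := by
    rw [← mul_assoc, Complex.I_mul_I]; ring
  simp [hiip]
  rw [hip]
  generalize fderiv ℝ (fderiv ℝ w) z = Q at *
  generalize p.re = x at *
  generalize p.im = y at *
  rw [hn, hpe]
  simp only [map_add, map_smul, add_apply, smul_apply,
    smul_eq_mul]
  ring

theorem mul_posLog_div {R r : ℝ} (hR : 0 < R) (hr : 0 < r) (hrR : r ≤ R) :
    r * log⁺ (R / r) = r * log R - r * log r := by
  rw [posLog_eq_log, log_div hR.ne' hr.ne']
  · ring
  · rw [abs_of_pos (by positivity)]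
    exact (one_le_div hr).2 hrR

theorem posLog_div_eq_zero {R r : ℝ} (hR : 0 < R) (hr : 0 < r) (hrR : R ≤ r) :
    log⁺ (R / r) = 0 := by
  rw [posLog_eq_zero_iff, abs_of_pos (by positivity)]
  exact (div_le_one hr).2 hrR

theorem integrable_posLog_div_norm {R : ℝ} (hR : 0 < R) (c : ℂ) :
    Integrable fun z : ℂ => log⁺ (R / ‖z - c‖) := by
  suffices h : Integrable fun z : ℂ => log⁺ (R / ‖z‖) from h.comp_sub_right c
  rw [integrable_fun_norm_addHaar volume (f := fun t => log⁺ (R / t))]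
  rw [← Ioc_union_Ioi_eq_Ioi hR.le]
  refine IntegrableOn.union ?_ ?_
  · have : Continuous fun r : ℝ => r * log R - r * log r :=
      (continuous_id.mul continuous_const).sub continuous_mul_log
    refine (this.integrableOn_Ioc (a := 0) (b := R)).congr_fun (fun r hr => ?_) measurableSet_Ioc
    simp [mul_posLog_div hR hr.1 hr.2]
  · refine integrableOn_zero.congr_fun (fun r hr => ?_) measurableSet_Ioi
    simp [posLog_div_eq_zero hR (hR.trans hr) (le_of_lt hr)]

theorem abs_circleAverage_le_of_forall {f : ℂ → ℝ} {c : ℂ} {r C : ℝ} (hr : 0 ≤ r)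
    (hf : ContinuousOn f (sphere c r)) (h : ∀ z ∈ sphere c r, |f z| ≤ C) :
    |circleAverage f c r| ≤ C := by
  refine abs_circleAverage_le_circleAverage_abs.trans
    (circleAverage_mono_on_of_le_circle ?_ ?_)
  · exact (hf.abs).circleIntegrable hr
  · rw [abs_of_nonneg hr]; exact h

theorem continuousOn_circleAverage_Icc {f : ℂ → ℝ} {c : ℂ} {R : ℝ}
    (hf : ContinuousOn f (closedBall c R)) :
    ContinuousOn (circleAverage f c) (Icc 0 R) :=
  ContinuousOn.circleAverage (hf.mono fun z hz => by
    rw [mem_closedBall, dist_eq_norm]; exact hz.2) fun _ hr => hr.1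

open Laplacian InnerProductSpace Filter Topology in
/-- Jensen-type formula: the defect of the mean value property of a `C²` function. -/
theorem circleAverage_sub_eq_intervalIntegral {U : Set ℂ} (hUo : IsOpen U) {w : ℂ → ℝ}
    (hw : ContDiffOn ℝ 2 w U) {c : ℂ} {R : ℝ} (hR : 0 < R) (hU : closedBall c R ⊆ U) :
    circleAverage w c R - w c =
      ∫ r in (0:ℝ)..R, (r * log R - r * log r) * circleAverage (Δ w) c r := by
  have hD : ContDiffOn ℝ 1 (fderiv ℝ w) U := hw.fderiv_of_isOpen hUo (by norm_num)
  have hDc : ContinuousOn (fderiv ℝ w) (closedBall c R) := hD.continuousOn.mono hU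
  have hcL : ContinuousOn (Δ w) (closedBall c R) := by
    rw [laplacian_eq_iteratedFDeriv_complexPlane]
    simp only [iteratedFDeriv_two_apply]
    have := (hD.continuousOn_fderiv_of_isOpen hUo le_rfl).mono hU
    exact ((this.clm_apply continuousOn_const).clm_apply continuousOn_const).add
      ((this.clm_apply continuousOn_const).clm_apply continuousOn_const)
  have hBc : ContinuousOn (fun z => fderiv ℝ w z (z - c)) (closedBall c R) :=
    hDc.clm_apply (by fun_prop)
  set A := circleAverage w c with hA
  set B := circleAverage (fun z => fderiv ℝ w z (z - c)) c with hB
  have hAcont : ContinuousOn A (Icc 0 R) :=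
    continuousOn_circleAverage_Icc (hw.continuousOn.mono hU)
  have hBcont : ContinuousOn B (Icc 0 R) := continuousOn_circleAverage_Icc hBc
  have hLcont : ContinuousOn (circleAverage (Δ w) c) (Icc 0 R) := continuousOn_circleAverage_Icc hcL
  obtain ⟨M, hM⟩ := (isCompact_closedBall c R).exists_bound_of_continuousOn hDc
  have hBbd : ∀ r ∈ Icc 0 R, |B r| ≤ M * r := by
    intro r hr
    have hsub : sphere c r ⊆ closedBall c R :=
      sphere_subset_closedBall.trans (closedBall_subset_closedBall hr.2)
    refine abs_circleAverage_le_of_forall hr.1 (hBc.mono hsub) fun z hz => ?_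
    have h1 := (fderiv ℝ w z).le_opNorm (z - c)
    rw [mem_sphere, dist_eq_norm] at hz
    rw [hz] at h1
    exact h1.trans (mul_le_mul_of_nonneg_right (hM z (hsub (by
      rw [mem_sphere, dist_eq_norm, hz]))) hr.1)
  have hmul : Continuous fun r : ℝ => r * log R - r * log r :=
    (continuous_id.mul continuous_const).sub continuous_mul_log
  have hB0 : B 0 = 0 := by simp [hB]
  have hA0 : A 0 = w c := by simp [hA]
  have hsph : ∀ r ∈ Ioo 0 R, sphere c r ⊆ U := fun r hr =>
    (sphere_subset_closedBall.trans (closedBall_subset_closedBall hr.2.le)).trans hU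
  have hE : ContinuousOn (fun r => A r + (log R - log r) * B r) (Icc 0 R) := by
    refine hAcont.add fun r hr => ?_
    rcases hr.1.eq_or_lt with rfl | hr0
    · rw [ContinuousWithinAt, hB0, mul_zero]
      refine squeeze_zero_norm' (a := fun r => M * |r * log R - r * log r|) ?_ ?_
      · filter_upwards [self_mem_nhdsWithin] with r hr
        rw [norm_mul, norm_eq_abs, norm_eq_abs, ← mul_sub, abs_mul, abs_of_nonneg hr.1]
        calc |log R - log r| * |B r| ≤ |log R - log r| * (M * r) :=
              mul_le_mul_of_nonneg_left (hBbd r hr) (abs_nonneg _)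
          _ = M * (r * |log R - log r|) := by ring
      · have : Continuous fun r : ℝ => M * |r * log R - r * log r| := by fun_prop
        have h := this.tendsto 0
        rw [zero_mul, zero_mul, sub_zero, abs_zero, mul_zero] at h
        exact h.mono_left nhdsWithin_le_nhds
    · exact ((continuousAt_const.sub (continuousAt_log hr0.ne')).continuousWithinAt).mul (hBcont r hr)
  have hderiv : ∀ r ∈ Ioo 0 R, HasDerivAt (fun r => A r + (log R - log r) * B r)
      ((r * log R - r * log r) * circleAverage (Δ w) c r) r := by
    intro r hr
    have h1 := hasDerivAt_circleAverage hUo (hw.of_le (by norm_num)) le_rfl hsph hr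
    have h2 := hasDerivAt_circleAverage_radial hUo hw le_rfl hsph hr
    have h3 := h1.add (((hasDerivAt_log hr.1.ne').const_sub (log R)).mul h2)
    refine h3.congr_deriv ?_
    ring
  have := intervalIntegral.integral_eq_sub_of_hasDerivAt_of_le hR.le hE hderiv
    ((hmul.continuousOn.mul hLcont).intervalIntegrable_of_Icc hR.le)
  rw [this, hA0, hB0]
  ring

open Laplacian InnerProductSpace in
/-- Jensen-type formula, as an integral over the plane. -/
theorem circleAverage_sub_eq_integral {U : Set ℂ} (hUo : IsOpen U) {w : ℂ → ℝ}
    (hw : ContDiffOn ℝ 2 w U) {c : ℂ} {R : ℝ} (hR : 0 < R) (hU : closedBall c R ⊆ U) :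
    2 * π * (circleAverage w c R - w c) = ∫ z, log⁺ (R / ‖z - c‖) * Δ w z := by
  have hD : ContDiffOn ℝ 1 (fderiv ℝ w) U := hw.fderiv_of_isOpen hUo (by norm_num)
  have hcL : ContinuousOn (Δ w) (closedBall c R) := by
    rw [laplacian_eq_iteratedFDeriv_complexPlane]
    simp only [iteratedFDeriv_two_apply]
    have := (hD.continuousOn_fderiv_of_isOpen hUo le_rfl).mono hU
    exact ((this.clm_apply continuousOn_const).clm_apply continuousOn_const).add
      ((this.clm_apply continuousOn_const).clm_apply continuousOn_const)
  have hzero : ∀ z ∉ closedBall c R, log⁺ (R / ‖z - c‖) = 0 := fun z hz => by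
    rw [mem_closedBall, dist_eq_norm, not_le] at hz
    exact posLog_div_eq_zero hR (hR.trans hz) hz.le
  have hint : Integrable fun z => log⁺ (R / ‖z - c‖) * Δ w z := by
    have h1 : IntegrableOn (fun z => log⁺ (R / ‖z - c‖) * Δ w z) (closedBall c R) := by
      obtain ⟨M, hM⟩ := (isCompact_closedBall c R).exists_bound_of_continuousOn hcL
      refine ((integrable_posLog_div_norm hR c).integrableOn).mul_bdd (c := M)
        (hcL.aestronglyMeasurable measurableSet_closedBall) ?_
      exact (ae_restrict_mem measurableSet_closedBall).mono fun z hz => hM z hz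
    refine (integrableOn_iff_integrable_of_support_subset ?_).1 h1
    intro z hz
    by_contra h
    exact hz (by simp [hzero z h])
  rw [integral_eq_integral_circleAverage hint c, circleAverage_sub_eq_intervalIntegral hUo hw hR hU,
    intervalIntegral.integral_of_le hR.le, ← integral_const_mul]
  rw [← Ioc_union_Ioi_eq_Ioi hR.le, setIntegral_union (Ioc_disjoint_Ioi le_rfl) measurableSet_Ioi
    ((integrableOn_circleAverage hint c).mono_set Ioc_subset_Ioi_self)
    ((integrableOn_circleAverage hint c).mono_set (Ioi_subset_Ioi hR.le))]
  rw [setIntegral_congr_fun (s := Ioi R) (g := fun _ => (0:ℝ)) measurableSet_Ioi]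
  · rw [integral_zero, add_zero]
    refine setIntegral_congr_fun measurableSet_Ioc fun r hr => ?_
    rw [circleAverage_radial_mul (fun t => log⁺ (R / t)) _ _ hr.1.le,
      ← mul_posLog_div hR hr.1 hr.2]
    ring
  · intro r hr
    simp only
    rw [circleAverage_radial_mul (fun t => log⁺ (R / t)) _ _ (hR.le.trans (le_of_lt hr)),
      posLog_div_eq_zero hR (hR.trans hr) (le_of_lt hr)]
    ring

/-- The logarithmic potential of `g`, with the kernel truncated at distance one. -/
def logPotential (g : ℂ → ℝ) (z : ℂ) : ℝ := ∫ y, log⁺ (1 / ‖z - y‖) * g y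

theorem integrable_logPotential {g : ℂ → ℝ} (hg : Integrable g) : Integrable (logPotential g) := by
  have h1 : Integrable fun z : ℂ => log⁺ (1 / ‖z‖) := by
    simpa using integrable_posLog_div_norm one_pos 0
  have h2 := hg.integrable_convolution (ContinuousLinearMap.mul ℝ ℝ) h1
  refine h2.congr (Filter.Eventually.of_forall fun z => ?_)
  simp only [convolution_def, ContinuousLinearMap.mul_apply', logPotential]
  simp only [mul_comm]

theorem integrable_posLog_div_norm_mul {g : ℂ → ℝ} (hg : Integrable g) {R : ℝ} (hR : 0 < R) {c : ℂ}
    {δ M : ℝ} (hδ : 0 < δ) (hM : ∀ y ∈ ball c δ, |g y| ≤ M) :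
    Integrable fun y => log⁺ (R / ‖c - y‖) * g y := by
  have hmeas : Measurable fun y : ℂ => log⁺ (R / ‖c - y‖) := by
    simp only [posLog_def]
    fun_prop
  refine (((integrable_posLog_div_norm hR c).const_mul M).add
    (hg.norm.const_mul (log⁺ (R / δ)))).mono' (hmeas.aestronglyMeasurable.mul hg.1) ?_
  refine Filter.Eventually.of_forall fun y => ?_
  rw [norm_mul, norm_eq_abs, norm_eq_abs, abs_of_nonneg posLog_nonneg]
  simp only [Pi.add_apply, norm_eq_abs]
  rw [norm_sub_rev c y]
  by_cases hy : y ∈ ball c δ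
  · have := mul_le_mul_of_nonneg_left (hM y hy) (posLog_nonneg (x := R / ‖y - c‖))
    have := mul_nonneg (posLog_nonneg (x := R / δ)) (abs_nonneg (g y))
    linarith
  · rw [mem_ball, dist_eq_norm, not_lt] at hy
    have h1 : log⁺ (R / ‖y - c‖) ≤ log⁺ (R / δ) :=
      posLog_le_posLog (by positivity) (by gcongr)
    have := mul_le_mul_of_nonneg_right h1 (abs_nonneg (g y))
    have := mul_nonneg (posLog_nonneg (x := R / ‖y - c‖)) (abs_nonneg (g y))
    have hM0 : 0 ≤ M := (abs_nonneg _).trans (hM c (mem_ball_self hδ))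
    have := mul_nonneg hM0 (posLog_nonneg (x := R / ‖y - c‖))
    linarith

theorem posLog_one_div_of_le_one {t : ℝ} (h0 : 0 ≤ t) (h1 : t ≤ 1) : log⁺ (1 / t) = -log t := by
  rcases h0.eq_or_lt with rfl | h0
  · simp
  · rw [posLog_eq_log, one_div, log_inv]
    rw [abs_of_pos (by positivity)]
    exact (one_le_div h0).2 h1

theorem circleAverage_posLog_one_div {c y : ℂ} {r : ℝ} (hr : 0 < r)
    (h : ∀ z ∈ closedBall c r, ‖z - y‖ ≤ 1) :
    CircleIntegrable (fun z => log⁺ (1 / ‖z - y‖)) c r ∧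
      circleAverage (fun z => log⁺ (1 / ‖z - y‖)) c r = -log r - log⁺ (r⁻¹ * ‖c - y‖) := by
  have heq : EqOn (fun z => log⁺ (1 / ‖z - y‖)) (fun z => -log ‖z - y‖) (sphere c |r|) := by
    intro z hz
    rw [abs_of_pos hr] at hz
    exact posLog_one_div_of_le_one (norm_nonneg _) (h z (sphere_subset_closedBall hz))
  have hc : CircleIntegrable (fun z => -log ‖z - y‖) c r :=
    (circleIntegrable_log_norm_sub_const r).neg
  refine ⟨(circleIntegrable_congr heq).2 hc, ?_⟩
  rw [circleAverage_congr_sphere heq]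
  have := circleAverage_log_norm_sub_const_eq_log_radius_add_posLog (c := c) (a := y) hr.ne'
  have h2 : circleAverage (fun z => -log ‖z - y‖) c r = -circleAverage (log ‖· - y‖) c r :=
    by simp [circleAverage_def]
  rw [h2, this]
  ring

theorem posLog_one_div_sub_posLog_div {d r : ℝ} (hr : 0 < r) (hd : 0 < d) (hd1 : d ≤ 1) :
    log⁺ (1 / d) - log⁺ (r / d) = -log r - log⁺ (r⁻¹ * d) := by
  have h1 := posLog_sub_posLog_inv (x := r⁻¹ * d)
  rw [posLog_one_div_of_le_one hd.le hd1]
  have h2 : (r⁻¹ * d)⁻¹ = r / d := by field_simp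
  rw [h2, log_mul (by positivity) hd.ne', log_inv] at h1
  linarith

/-- The defect in the mean value property of a logarithmic potential. -/
theorem logPotential_sub_circleAverage {g : ℂ → ℝ} (hg : Integrable g)
    (hsupp : ∀ y ∉ ball (0:ℂ) (1 / 2), g y = 0) {c : ℂ} {δ M r : ℝ} (hδ : 0 < δ)
    (hM : ∀ y ∈ ball c δ, |g y| ≤ M) (hr : 0 < r) (hc : closedBall c r ⊆ ball 0 (1 / 2)) :
    CircleIntegrable (logPotential g) c r ∧
    logPotential g c - circleAverage (logPotential g) c r =
      ∫ y, log⁺ (r / ‖c - y‖) * g y := by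
  have hdist : ∀ y ∈ ball (0:ℂ) (1 / 2), ∀ z ∈ closedBall c r, ‖z - y‖ ≤ 1 := by
    intro y hy z hz
    have := hc hz
    rw [mem_ball_zero_iff] at this hy
    linarith [norm_sub_le z y]
  set F : ℝ → ℂ → ℝ := fun θ y => log⁺ (1 / ‖circleMap c r θ - y‖) * g y with hF
  have hmeas : Measurable fun p : ℝ × ℂ => log⁺ (1 / ‖circleMap c r p.1 - p.2‖) := by
    have : Continuous fun p : ℝ × ℂ => circleMap c r p.1 - p.2 :=
      ((continuous_circleMap c r).comp continuous_fst).sub continuous_snd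
    simp only [posLog_def]
    have := this.measurable
    fun_prop
  have hsec : ∀ y, IntervalIntegrable (fun θ => F θ y) volume 0 (2 * π) := by
    intro y
    by_cases hy : y ∈ ball (0:ℂ) (1 / 2)
    · exact (circleAverage_posLog_one_div hr (hdist y hy)).1.mul_const _
    · simp [hF, hsupp y hy]
  have hval : ∀ y, y ≠ c → ∫ θ in (0:ℝ)..2 * π, F θ y =
      2 * π * ((log⁺ (1 / ‖c - y‖) - log⁺ (r / ‖c - y‖)) * g y) := by
    intro y hyc
    by_cases hy : y ∈ ball (0:ℂ) (1 / 2)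
    · have h1 := (circleAverage_posLog_one_div hr (hdist y hy)).2
      have h2 := posLog_one_div_sub_posLog_div hr (norm_pos_iff.2 (sub_ne_zero.2 hyc.symm))
        (hdist y hy c (mem_closedBall_self hr.le))
      rw [← h2, circleAverage_def, smul_eq_mul, inv_mul_eq_iff_eq_mul₀ (by positivity)] at h1
      simp only [hF]
      rw [intervalIntegral.integral_mul_const, h1]
      ring
    · simp [hF, hsupp y hy]
  have hne : ∀ᵐ y : ℂ, y ≠ c := by
    rw [ae_iff]
    simp
  have hI1 := integrable_posLog_div_norm_mul hg one_pos hδ hM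
  have hIr := integrable_posLog_div_norm_mul hg hr hδ hM
  have hI : Integrable fun y => (log⁺ (1 / ‖c - y‖) - log⁺ (r / ‖c - y‖)) * g y := by
    simp only [sub_mul]
    exact hI1.sub hIr
  have hprod : Integrable (Function.uncurry F)
      ((volume.restrict (uIoc 0 (2 * π))).prod volume) := by
    have hFm : AEStronglyMeasurable (Function.uncurry F)
        ((volume.restrict (uIoc (0:ℝ) (2 * π))).prod volume) :=
      hmeas.aestronglyMeasurable.mul hg.1.comp_snd
    rw [integrable_prod_iff' hFm]
    refine ⟨Filter.Eventually.of_forall fun y => ?_, ?_⟩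
    · rw [uIoc_of_le two_pi_pos.le]
      exact ((intervalIntegrable_iff_integrableOn_Ioc_of_le two_pi_pos.le).1 (hsec y))
    · refine (hI.norm.const_mul (2 * π)).congr ?_
      filter_upwards [hne] with y hy
      have h3 := hval y hy
      have h4 : ∀ θ, ‖F θ y‖ = log⁺ (1 / ‖circleMap c r θ - y‖) * |g y| := fun θ => by
        rw [hF]; simp only [norm_mul, norm_eq_abs, abs_of_nonneg posLog_nonneg]
      rw [uIoc_of_le two_pi_pos.le, ← intervalIntegral.integral_of_le two_pi_pos.le]
      simp only [Function.uncurry_apply_pair, h4]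
      by_cases hg0 : g y = 0
      · simp [hg0]
      · have h5 : ∫ θ in (0:ℝ)..2 * π, log⁺ (1 / ‖circleMap c r θ - y‖) =
            2 * π * (log⁺ (1 / ‖c - y‖) - log⁺ (r / ‖c - y‖)) := by
          simp only [hF] at h3
          rw [intervalIntegral.integral_mul_const] at h3
          apply mul_right_cancel₀ hg0
          rw [h3]; ring
        have h6 : 0 ≤ ∫ θ in (0:ℝ)..2 * π, log⁺ (1 / ‖circleMap c r θ - y‖) :=
          intervalIntegral.integral_nonneg two_pi_pos.le fun _ _ => posLog_nonneg
        rw [intervalIntegral.integral_mul_const, norm_mul, norm_eq_abs, norm_eq_abs, ← mul_assoc]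
        congr 1
        rw [h5] at h6 ⊢
        rw [abs_of_nonneg (nonneg_of_mul_nonneg_right h6 two_pi_pos)]
  constructor
  · have := hprod.integral_prod_left
    rw [CircleIntegrable, intervalIntegrable_iff]
    exact this
  · have hsw := intervalIntegral_integral_swap hprod
    have h7 : circleAverage (logPotential g) c r =
        ∫ y, (log⁺ (1 / ‖c - y‖) - log⁺ (r / ‖c - y‖)) * g y := by
      rw [circleAverage_def, smul_eq_mul, inv_mul_eq_iff_eq_mul₀ (by positivity)]
      simp only [logPotential]
      rw [hsw, ← integral_const_mul]
      refine integral_congr_ae ?_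
      filter_upwards [hne] with y hy using hval y hy
    rw [h7, logPotential, ← integral_sub hI1 hI]
    congr 1
    ext y
    ring

/-- An integrable function with the mean value property is smooth. -/
theorem contDiffOn_of_circleAverage_eq {h : ℂ → ℝ} {x₀ : ℂ} {R : ℝ} (hR : 0 < R)
    (hint : IntegrableOn h (ball x₀ R))
    (hmv : ∀ x r, 0 < r → closedBall x r ⊆ ball x₀ R → circleAverage h x r = h x) :
    ContDiffOn ℝ 2 h (ball x₀ (R / 2)) := by
  set ε := R / 4 with hε
  have hε0 : 0 < ε := by positivity
  set k : ℝ → ℝ := fun r => smoothTransition (1 - r ^ 2 / ε ^ 2) with hk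
  set ρ : ℂ → ℝ := fun z => k ‖z‖ with hρ
  have hk0 : ∀ r, ε ≤ r → k r = 0 := fun r hr => by
    refine smoothTransition.zero_of_nonpos (sub_nonpos.2 ?_)
    rw [one_le_div (by positivity)]
    exact pow_le_pow_left₀ hε0.le hr 2
  have hρc : ContDiff ℝ 2 ρ := by
    have h1 : ContDiff ℝ 2 smoothTransition :=
      smoothTransition.contDiff (n := 2)
    exact h1.comp (contDiff_const.sub ((contDiff_norm_sq ℝ).div_const _))
  have hρs : HasCompactSupport ρ := by
    refine HasCompactSupport.intro (isCompact_closedBall (0:ℂ) ε) fun z hz => hk0 _ ?_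
    rw [mem_closedBall_zero_iff, not_le] at hz
    exact hz.le
  have hρint : Integrable ρ := hρc.continuous.integrable_of_hasCompactSupport hρs
  have hρpos : 0 < ∫ z, ρ z := by
    refine hρc.continuous.integral_pos_of_hasCompactSupport_nonneg_nonzero hρs
      (fun z => smoothTransition.nonneg _) (x := 0) ?_
    simp [hρ, hk, smoothTransition.one]
  set F : ℂ → ℝ := (ball x₀ R).indicator h with hF
  have hFint : Integrable F := hint.integrable_indicator measurableSet_ball
  have hconv := hρs.contDiff_convolution_right (n := 2) (ContinuousLinearMap.mul ℝ ℝ)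
    hFint.locallyIntegrable hρc
  refine (hconv.const_smul (∫ z, ρ z)⁻¹).contDiffOn.congr fun x hx => ?_
  have hbd : ∀ z, ‖ρ z‖ ≤ 1 := fun z => by
    rw [norm_eq_abs, abs_of_nonneg (smoothTransition.nonneg _)]
    exact smoothTransition.le_one _
  have hsub : ∀ r ≤ ε, closedBall x r ⊆ ball x₀ R := fun r hr => by
    refine (closedBall_subset_ball' (ε₂ := R) ?_)
    rw [mem_ball] at hx
    linarith
  have hm := integral_radial_mul_eq (F := F) (k := k) (c := x) (m := h x)
    (hFint.bdd_mul (hρc.continuous.comp (continuous_id.sub continuous_const)).aestronglyMeasurable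
      (Filter.Eventually.of_forall fun z => hbd (z - x))) (hρint.comp_sub_right x) (by
      intro r hr hkr
      have hrε : r ≤ ε := by
        by_contra hh
        exact hkr (hk0 r (not_le.1 hh).le)
      rw [← hmv x r hr (hsub r hrε)]
      refine circleAverage_congr_sphere fun z hz => ?_
      rw [abs_of_pos hr] at hz
      exact indicator_of_mem (hsub r hrε (sphere_subset_closedBall hz)) _)
  have h3 : (∫ z, k ‖z - x‖) = ∫ z, ρ z := integral_sub_right_eq_self ρ x
  rw [h3] at hm
  have h4 : convolution F ρ (ContinuousLinearMap.mul ℝ ℝ) volume x = h x * ∫ z, ρ z := by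
    rw [← hm, convolution_def]
    congr 1
    ext z
    simp only [ContinuousLinearMap.mul_apply', hρ, norm_sub_rev x z]
    ring
  change h x = (∫ z, ρ z)⁻¹ * convolution F ρ (ContinuousLinearMap.mul ℝ ℝ) volume x
  rw [h4]
  field_simp

open Laplacian InnerProductSpace in
theorem laplacian_eq_zero_of_circleAverage_eq {U : Set ℂ} (hUo : IsOpen U) {w : ℂ → ℝ}
    (hw : ContDiffOn ℝ 2 w U) {c : ℂ} {R : ℝ} (hR : 0 < R) (hU : closedBall c R ⊆ U)
    (hmv : ∀ r ∈ Ioo 0 R, circleAverage w c r = w c) : Δ w c = 0 := by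
  have hsph : ∀ r ∈ Ioo 0 R, sphere c r ⊆ U := fun r hr =>
    (sphere_subset_closedBall.trans (closedBall_subset_closedBall hr.2.le)).trans hU
  have hD : ContDiffOn ℝ 1 (fderiv ℝ w) U := hw.fderiv_of_isOpen hUo (by norm_num)
  have hcL : ContinuousOn (Δ w) (closedBall c R) := by
    rw [laplacian_eq_iteratedFDeriv_complexPlane]
    simp only [iteratedFDeriv_two_apply]
    have := (hD.continuousOn_fderiv_of_isOpen hUo le_rfl).mono hU
    exact ((this.clm_apply continuousOn_const).clm_apply continuousOn_const).add
      ((this.clm_apply continuousOn_const).clm_apply continuousOn_const)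
  have hB : ∀ r ∈ Ioo 0 R, circleAverage (fun z => fderiv ℝ w z (z - c)) c r = 0 := by
    intro r hr
    have h1 := hasDerivAt_circleAverage hUo (hw.of_le (by norm_num)) le_rfl hsph hr
    have h2 : HasDerivAt (circleAverage w c) 0 r :=
      (hasDerivAt_const r (w c)).congr_of_eventuallyEq
        (Filter.eventuallyEq_of_mem (isOpen_Ioo.mem_nhds hr) hmv)
    have := h1.unique h2
    exact (mul_eq_zero.1 this).resolve_left (inv_ne_zero hr.1.ne')
  have hL : ∀ r ∈ Ioo 0 R, circleAverage (Δ w) c r = 0 := by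
    intro r hr
    have h1 := hasDerivAt_circleAverage_radial hUo hw le_rfl hsph hr
    have h2 : HasDerivAt (circleAverage (fun z => fderiv ℝ w z (z - c)) c) 0 r :=
      (hasDerivAt_const r (0:ℝ)).congr_of_eventuallyEq
        (Filter.eventuallyEq_of_mem (isOpen_Ioo.mem_nhds hr) hB)
    have := h1.unique h2
    exact (mul_eq_zero.1 this).resolve_left hr.1.ne'
  have hc := (continuousOn_circleAverage_Icc hcL) 0 ⟨le_rfl, hR.le⟩
  have h5 : Filter.Tendsto (circleAverage (Δ w) c) (nhdsWithin 0 (Ioo 0 R)) (nhds (Δ w c)) := by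
    have := hc.mono (Ioo_subset_Icc_self)
    rw [ContinuousWithinAt, circleAverage_zero] at this
    exact this
  have h6 : Filter.Tendsto (circleAverage (Δ w) c) (nhdsWithin 0 (Ioo 0 R)) (nhds 0) :=
    tendsto_const_nhds.congr' (Filter.eventuallyEq_of_mem self_mem_nhdsWithin
      fun r hr => (hL r hr).symm)
  have : (nhdsWithin (0:ℝ) (Ioo 0 R)).NeBot := by
    rw [← mem_closure_iff_nhdsWithin_neBot, closure_Ioo hR.ne]
    exact ⟨le_rfl, hR.le⟩
  exact tendsto_nhds_unique h5 h6

open InnerProductSpace in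
/-- An integrable function with the mean value property is harmonic. -/
theorem harmonicAt_of_circleAverage_eq {h : ℂ → ℝ} {x₀ : ℂ} {R : ℝ} (hR : 0 < R)
    (hint : IntegrableOn h (ball x₀ R))
    (hmv : ∀ x r, 0 < r → closedBall x r ⊆ ball x₀ R → circleAverage h x r = h x) :
    HarmonicAt h x₀ := by
  have hC := contDiffOn_of_circleAverage_eq hR hint hmv
  have hx : x₀ ∈ ball x₀ (R / 2) := mem_ball_self (by positivity)
  refine ⟨hC.contDiffAt (isOpen_ball.mem_nhds hx),
    Filter.eventuallyEq_of_mem (isOpen_ball.mem_nhds hx) fun x hx => ?_⟩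
  obtain ⟨s, hs, hsub⟩ := nhds_basis_closedBall.mem_iff.1 (isOpen_ball.mem_nhds hx)
  refine laplacian_eq_zero_of_circleAverage_eq isOpen_ball hC hs hsub fun r hr => ?_
  exact hmv x r hr.1 ((closedBall_subset_closedBall hr.2.le).trans
    (hsub.trans (ball_subset_ball (by linarith))))

open Laplacian InnerProductSpace in
theorem continuousOn_laplacian {U : Set ℂ} (hUo : IsOpen U) {w : ℂ → ℝ}
    (hw : ContDiffOn ℝ 2 w U) : ContinuousOn (Δ w) U := by
  have hD : ContDiffOn ℝ 1 (fderiv ℝ w) U := hw.fderiv_of_isOpen hUo (by norm_num)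
  rw [laplacian_eq_iteratedFDeriv_complexPlane]
  simp only [iteratedFDeriv_two_apply]
  have := (hD.continuousOn_fderiv_of_isOpen hUo le_rfl)
  exact ((this.clm_apply continuousOn_const).clm_apply continuousOn_const).add
    ((this.clm_apply continuousOn_const).clm_apply continuousOn_const)

open Laplacian in
/-- The density of the Riesz measure of `-w` on the punctured disc of radius `1 / 2`. -/
def rieszDensity (w : ℂ → ℝ) : ℂ → ℝ :=
  (ball (0:ℂ) (1 / 2) \ {0}).indicator fun z => -(Δ w z) / (2 * π)

theorem isOpen_ball_diff_zero (r : ℝ) : IsOpen (ball (0:ℂ) r \ {0}) :=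
  isOpen_ball.sdiff isClosed_singleton

open Laplacian InnerProductSpace in
/-- Subtracting the logarithmic potential of its Riesz measure makes a function harmonic. -/
theorem harmonicOnNhd_sub_logPotential {w : ℂ → ℝ} (hw : ContDiffOn ℝ 2 w (ball 0 1 \ {0}))
    (hg : Integrable (rieszDensity w)) :
    HarmonicOnNhd (fun z => w z - logPotential (rieszDensity w) z) (ball 0 (1 / 2) \ {0}) := by
  set g := rieszDensity w with hgdef
  set V := ball (0:ℂ) (1 / 2) \ {0} with hV
  have hVU : V ⊆ ball (0:ℂ) 1 \ {0} := sdiff_subset_sdiff_left (ball_subset_ball (by norm_num))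
  have hVo : IsOpen V := isOpen_ball_diff_zero _
  intro x₀ hx₀
  obtain ⟨R, hR, hsub⟩ := nhds_basis_closedBall.mem_iff.1 (hVo.mem_nhds hx₀)
  have hwc : ContinuousOn w (closedBall x₀ R) := hw.continuousOn.mono (hsub.trans hVU)
  refine harmonicAt_of_circleAverage_eq hR ?_ fun x r hr hxr => ?_
  · exact ((hwc.integrableOn_compact (isCompact_closedBall _ _)).mono_set ball_subset_closedBall).sub
      (integrable_logPotential hg).integrableOn
  · have hxrV : closedBall x r ⊆ V := hxr.trans (ball_subset_closedBall.trans hsub)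
    have hΔ : ContinuousOn (Δ w) (closedBall x r) :=
      (continuousOn_laplacian (isOpen_ball_diff_zero _) hw).mono (hxrV.trans hVU)
    obtain ⟨M, hM⟩ := (isCompact_closedBall x r).exists_bound_of_continuousOn (hΔ.neg.div_const (2 * π))
    have hgval : ∀ z ∈ closedBall x r, g z = -(Δ w z) / (2 * π) := fun z hz =>
      indicator_of_mem (hxrV hz) _
    have hwcirc : CircleIntegrable w x r :=
      (hwc.mono (sphere_subset_closedBall.trans (hxr.trans ball_subset_closedBall))).circleIntegrable hr.le
    obtain ⟨hNc, hN⟩ := logPotential_sub_circleAverage hg (fun y hy => indicator_of_notMem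
      (fun h => hy h.1) _) hr (fun y hy => by
        rw [hgval y (ball_subset_closedBall hy)]; exact hM y (ball_subset_closedBall hy)) hr
        (hxrV.trans sdiff_subset)
    have hJ := circleAverage_sub_eq_integral (isOpen_ball_diff_zero 1) hw hr (hxrV.trans hVU)
    have hI : ∫ z, log⁺ (r / ‖z - x‖) * Δ w z =
        -(2 * π) * ∫ y, log⁺ (r / ‖x - y‖) * g y := by
      rw [← integral_const_mul]
      congr 1
      ext z
      rw [norm_sub_rev x z]
      by_cases hz : z ∈ closedBall x r
      · rw [hgval z hz]
        field_simp
      · rw [mem_closedBall, dist_eq_norm, not_le] at hz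
        rw [posLog_div_eq_zero hr (hr.trans hz) hz.le]
        ring
    have hsubav : circleAverage (fun z => w z - logPotential g z) x r =
        circleAverage w x r - circleAverage (logPotential g) x r :=
      circleAverage_fun_sub hwcirc hNc
    rw [hI] at hJ
    rw [hsubav]
    have h2 : circleAverage w x r - w x = - ∫ y, log⁺ (r / ‖x - y‖) * g y := by
      have : (2 * π) * (circleAverage w x r - w x) =
        (2 * π) * (- ∫ y, log⁺ (r / ‖x - y‖) * g y) := by rw [hJ]; ring
      exact mul_left_cancel₀ two_pi_pos.ne' this
    linarith

open InnerProductSpace in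
/-- Gradient estimate for positive harmonic functions. -/
theorem abs_fderiv_le_of_harmonicOnNhd_pos {f : ℂ → ℝ} {c : ℂ} {R : ℝ} (hR : 0 < R)
    (hf : HarmonicOnNhd f (ball c R)) (hpos : ∀ z ∈ ball c R, 0 < f z) (v : ℂ) :
    |fderiv ℝ f c v| ≤ 4 * f c / R * ‖v‖ := by
  obtain ⟨F, hFa, hFre⟩ := hf.exists_analyticOnNhd_ball_re_eq
  have hc : c ∈ ball c R := mem_ball_self hR
  have hmem : ∀ u ∈ ball (0:ℂ) R, c + u ∈ ball c R := fun u hu => by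
    rw [mem_ball_zero_iff] at hu
    rw [mem_ball, dist_eq_norm]
    simpa using hu
  have hd : HasDerivAt F (deriv F c) c := (hFa c hc).differentiableAt.hasDerivAt
  set G : ℂ → ℂ := fun u => F c - F (c + u) with hG
  have hGd : DifferentiableOn ℂ G (ball 0 R) := fun u hu => by
    have := ((hFa _ (hmem u hu)).differentiableAt).comp u
      ((differentiableAt_const c).add differentiableAt_id)
    exact ((differentiableAt_const _).sub this).differentiableWithinAt
  have hre : ∀ z ∈ ball c R, (F z).re = f z := fun z hz => hFre hz
  have hGre : MapsTo G (ball 0 R) {z | z.re ≤ f c} := fun u hu => by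
    have h1 := hre _ (hmem u hu)
    have h2 := hpos _ (hmem u hu)
    simp only [mem_ofPred_eq, hG, Complex.sub_re, hre c hc, h1]
    linarith
  have hbound : ∀ᶠ u in nhds (0:ℂ), ‖G u - G 0‖ ≤ 4 * f c / R * ‖u - 0‖ := by
    filter_upwards [ball_mem_nhds (0:ℂ) (half_pos hR)] with u hu
    have hu' : ‖u‖ < R / 2 := mem_ball_zero_iff.1 hu
    have h1 := Complex.borelCaratheodory_zero (hpos c hc) hGd hGre hR
      (ball_subset_ball (by linarith) hu) (by simp [hG])
    have h0 : G 0 = 0 := by simp [hG]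
    rw [h0, sub_zero, sub_zero]
    refine h1.trans ?_
    rw [div_le_iff₀ (by linarith)]
    have h2 : 4 * f c / R * ‖u‖ * (R / 2) ≤ 4 * f c / R * ‖u‖ * (R - ‖u‖) := by
      have := hpos c hc
      gcongr
      linarith
    have h3 : 4 * f c / R * ‖u‖ * (R / 2) = 2 * f c * ‖u‖ := by field_simp; ring
    linarith
  have hGder : HasDerivAt G (-deriv F c) 0 := by
    have h1 : HasDerivAt (fun u : ℂ => F (c + u)) (deriv F c) 0 := by
      have h2 : HasDerivAt F (deriv F c) (c + 0) := by simpa using hd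
      exact h2.comp_const_add c 0
    exact h1.const_sub _
  have hnorm : ‖deriv F c‖ ≤ 4 * f c / R := by
    have := hpos c hc
    have h1 := hGder.hasFDerivAt.le_of_lip' (C := 4 * f c / R) (by positivity) hbound
    simpa using h1
  have hfd : HasFDerivAt f (Complex.reCLM.comp
      ((ContinuousLinearMap.toSpanSingleton ℂ (deriv F c)).restrictScalars ℝ)) c := by
    have h1 := Complex.reCLM.hasFDerivAt.comp c (hd.hasFDerivAt.restrictScalars ℝ)
    refine h1.congr_of_eventuallyEq ?_
    exact Filter.eventuallyEq_of_mem (isOpen_ball.mem_nhds hc) fun z hz => (hre z hz).symm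
  rw [hfd.fderiv]
  have h5 : |(v * deriv F c).re| ≤ ‖v * deriv F c‖ := Complex.abs_re_le_norm _
  rw [norm_mul] at h5
  have h6 := mul_le_mul_of_nonneg_left hnorm (norm_nonneg v)
  simp only [ContinuousLinearMap.comp_apply, ContinuousLinearMap.coe_restrictScalars',
    ContinuousLinearMap.toSpanSingleton_apply, smul_eq_mul, Complex.reCLM_apply]
  linarith

open InnerProductSpace in
theorem HarmonicAt.comp_analyticAt {p : ℂ → ℝ} {f : ℂ → ℂ} {ζ : ℂ} (hp : HarmonicAt p (f ζ))
    (hf : AnalyticAt ℂ f ζ) : HarmonicAt (fun z => p (f z)) ζ := by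
  obtain ⟨ε, hε, hsub⟩ := isOpen_iff.1 (isOpen_setOfPred_harmonicAt (f := p)) _ hp
  obtain ⟨F, hFa, hFre⟩ := InnerProductSpace.HarmonicOnNhd.exists_analyticOnNhd_ball_re_eq
    (fun _ hy ↦ hsub hy)
  have h1 : HarmonicAt (fun z => (F (f z)).re) ζ :=
    ((hFa _ (mem_ball_self hε)).comp hf).harmonicAt_re
  refine (harmonicAt_congr_nhds ?_).1 h1
  filter_upwards [hf.continuousAt (ball_mem_nhds _ hε)] with z hz
  exact hFre hz

open InnerProductSpace in
/-- Gradient estimate for positive harmonic functions in a punctured disc. -/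
theorem abs_fderiv_le_of_harmonicOnNhd_punctured {p : ℂ → ℝ} {R : ℝ}
    (hp : HarmonicOnNhd p (ball 0 R \ {0})) (hpos : ∀ z ∈ ball 0 R \ {0}, 0 < p z)
    {z : ℂ} (hz : z ∈ ball 0 R \ {0}) (v : ℂ) :
    |fderiv ℝ p z (z * v)| ≤ 4 * p z / (log R - log ‖z‖) * ‖v‖ := by
  have hz0 : z ≠ 0 := hz.2
  have hzn : 0 < ‖z‖ := norm_pos_iff.2 hz0
  have hzR : ‖z‖ < R := mem_ball_zero_iff.1 hz.1
  have hlog : 0 < log R - log ‖z‖ := sub_pos.2 (log_lt_log hzn hzR)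
  set ζ := Complex.log z with hζ
  have hexp : Complex.exp ζ = z := Complex.exp_log hz0
  have hmem : ∀ ξ ∈ ball ζ (log R - log ‖z‖), Complex.exp ξ ∈ ball 0 R \ {0} := by
    intro ξ hξ
    refine ⟨?_, Complex.exp_ne_zero ξ⟩
    rw [mem_ball_zero_iff, Complex.norm_exp, ← lt_log_iff_exp_lt (hzn.trans hzR)]
    rw [mem_ball, dist_eq_norm] at hξ
    have h1 := Complex.re_le_norm (ξ - ζ)
    rw [Complex.sub_re, hζ, Complex.log_re] at h1
    linarith
  have h := abs_fderiv_le_of_harmonicOnNhd_pos (f := fun ξ => p (Complex.exp ξ)) hlog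
    (fun ξ hξ => HarmonicAt.comp_analyticAt (hp _ (hmem ξ hξ)) (by fun_prop))
    (fun ξ hξ => hpos _ (hmem ξ hξ)) v
  have hd : DifferentiableAt ℝ p (Complex.exp ζ) := by
    rw [hexp]; exact (hp z hz).1.differentiableAt (by norm_num)
  have hfd := hd.hasFDerivAt.comp ζ
    ((Complex.hasDerivAt_exp ζ).hasFDerivAt.restrictScalars ℝ)
  have h2 : fderiv ℝ (fun ξ => p (Complex.exp ξ)) ζ v = fderiv ℝ p z (z * v) := by
    have := hfd.fderiv
    simp only [Function.comp_def] at this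
    rw [this]
    simp [hexp, mul_comm]
  rw [h2] at h
  simpa only [hexp] using h

open InnerProductSpace in
/-- Growth of positive harmonic functions near a puncture. -/
theorem exists_le_log_pow_of_harmonicOnNhd_punctured {p : ℂ → ℝ} {R : ℝ} (hR : 0 < R)
    (hp : HarmonicOnNhd p (ball 0 R \ {0})) (hpos : ∀ z ∈ ball 0 R \ {0}, 0 < p z) :
    ∃ C, ∀ z ∈ ball (0:ℂ) (R / 2) \ {0}, p z ≤ C * (log R - log ‖z‖) ^ 4 := by
  have hsub : sphere (0:ℂ) (R / 2) ⊆ ball 0 R \ {0} := by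
    intro z hz
    rw [mem_sphere_zero_iff_norm] at hz
    refine ⟨by rw [mem_ball_zero_iff]; linarith, fun h => ?_⟩
    rw [mem_singleton_iff] at h
    rw [h, norm_zero] at hz
    linarith
  have hcont : ContinuousOn p (ball 0 R \ {0}) := hp.contDiffOn.continuousOn
  obtain ⟨M, hM⟩ := (isCompact_sphere (0:ℂ) (R / 2)).exists_bound_of_continuousOn (hcont.mono hsub)
  refine ⟨M / (log R - log (R / 2)) ^ 4, fun z hz => ?_⟩
  have hz0 : z ≠ 0 := hz.2
  have hzn : 0 < ‖z‖ := norm_pos_iff.2 hz0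
  have hzR : ‖z‖ < R / 2 := mem_ball_zero_iff.1 hz.1
  set s₀ := log R with hs₀
  set b := log (R / 2) with hb
  have hbs : b < s₀ := log_lt_log (by positivity) (by linarith)
  have hab : log ‖z‖ ≤ b := log_le_log hzn hzR.le
  set e : ℝ → ℂ := fun s => (exp (s - log ‖z‖) : ℝ) * z with he
  have hen : ∀ s, ‖e s‖ = exp s := fun s => by
    rw [he]
    simp only [norm_mul, Complex.norm_real, norm_eq_abs, abs_of_pos (exp_pos _)]
    rw [exp_sub, exp_log hzn]
    field_simp
  have hemem : ∀ s < s₀, e s ∈ ball (0:ℂ) R \ {0} := fun s hs => by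
    refine ⟨?_, fun h => ?_⟩
    · rw [mem_ball_zero_iff, hen, ← lt_log_iff_exp_lt hR]; exact hs
    · rw [mem_singleton_iff] at h
      have := hen s
      rw [h, norm_zero] at this
      exact (exp_pos s).ne this
  have hed : ∀ s, HasDerivAt e (e s) s := fun s => by
    have h1 : HasDerivAt (fun s : ℝ => exp (s - log ‖z‖)) (exp (s - log ‖z‖)) s := by
      simpa using ((hasDerivAt_id s).sub_const (log ‖z‖)).exp
    exact h1.ofReal_comp.mul_const z
  have hφd : ∀ s < s₀, HasDerivAt (fun s => p (e s) / (s₀ - s) ^ 4)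
      ((fderiv ℝ p (e s) (e s) * (s₀ - s) + 4 * p (e s)) / (s₀ - s) ^ 5) s := fun s hs => by
    have h1 : HasDerivAt (fun s => p (e s)) (fderiv ℝ p (e s) (e s)) s :=
      (((hp _ (hemem s hs)).1.differentiableAt (by norm_num)).hasFDerivAt).comp_hasDerivAt s (hed s)
    have h2 := h1.div (((hasDerivAt_id s).const_sub s₀).pow 4) (by
      exact pow_ne_zero 4 (sub_pos.2 hs).ne')
    refine h2.congr_deriv ?_
    have := (sub_pos.2 hs).ne'
    simp only [id, Pi.pow_apply]
    field_simp
    push_cast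
    ring
  have hmono : MonotoneOn (fun s => p (e s) / (s₀ - s) ^ 4) (Icc (log ‖z‖) b) := by
    refine monotoneOn_of_deriv_nonneg (convex_Icc _ _)
      (fun s hs => (hφd s (hs.2.trans_lt hbs)).continuousAt.continuousWithinAt) ?_ ?_
    · intro s hs
      rw [interior_Icc] at hs
      exact (hφd s (hs.2.trans hbs)).differentiableAt.differentiableWithinAt
    · intro s hs
      rw [interior_Icc] at hs
      have hs0 := sub_pos.2 (hs.2.trans hbs)
      rw [(hφd s (hs.2.trans hbs)).deriv]
      refine div_nonneg ?_ (by positivity)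
      have h1 := abs_fderiv_le_of_harmonicOnNhd_punctured hp hpos (hemem s (hs.2.trans hbs)) 1
      rw [mul_one, hen, log_exp, norm_one, mul_one, le_div_iff₀ hs0] at h1
      have h2 := neg_abs_le (fderiv ℝ p (e s) (e s))
      nlinarith
  have h := hmono (left_mem_Icc.2 hab) (right_mem_Icc.2 hab) hab
  have hez : e (log ‖z‖) = z := by simp [he]
  simp only [hez] at h
  have hlz : 0 < s₀ - log ‖z‖ := by linarith
  rw [div_le_iff₀ (by positivity)] at h
  refine h.trans ?_
  have hlb : 0 < s₀ - b := by linarith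
  gcongr
  exact (le_abs_self _).trans (hM (e b) (by
    rw [mem_sphere_zero_iff_norm, hen, hb, exp_log (by positivity)]))

theorem isPreconnected_ball_diff_zero {R : ℝ} (hR : 0 < R) :
    IsPreconnected (ball (0:ℂ) R \ {0}) := by
  have h : ball (0:ℂ) R \ {0} = Complex.exp '' {z | z.re < log R} := by
    ext z
    constructor
    · rintro ⟨hz, hz0⟩
      refine ⟨Complex.log z, ?_, Complex.exp_log hz0⟩
      rw [mem_ball_zero_iff] at hz
      simp only [mem_ofPred_eq, Complex.log_re]
      exact log_lt_log (norm_pos_iff.2 hz0) hz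
    · rintro ⟨ζ, hζ, rfl⟩
      refine ⟨?_, Complex.exp_ne_zero ζ⟩
      rw [mem_ball_zero_iff, Complex.norm_exp, ← lt_log_iff_exp_lt hR]
      exact hζ
  rw [h]
  exact (convex_halfSpace_re_lt (log R)).isPreconnected.image _ Complex.continuous_exp.continuousOn

theorem hasFDerivAt_log_norm {z : ℂ} (hz : z ≠ 0) :
    HasFDerivAt (fun z : ℂ => log ‖z‖)
      (Complex.reCLM.comp ((ContinuousLinearMap.toSpanSingleton ℂ z⁻¹).restrictScalars ℝ)) z := by
  have h1 := ((hasStrictFDerivAt_norm_sq z).hasFDerivAt.log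
    (by positivity : ‖z‖ ^ 2 ≠ 0)).const_mul (1 / 2 : ℝ)
  have h2 : (fun y : ℂ => (1 / 2 : ℝ) * log (‖y‖ ^ 2)) = fun z : ℂ => log ‖z‖ := by
    ext y
    rw [log_pow]
    push_cast
    ring
  rw [h2] at h1
  refine h1.congr_fderiv ?_
  ext v
  simp [Complex.inv_re, Complex.inv_im, Complex.normSq_eq_norm_sq]
  field_simp
  ring

/-- The derivative of a real function on `ℂ` in terms of its complex partial derivative. -/
theorem fderiv_apply_eq_re (p : ℂ → ℝ) (z v : ℂ) :
    fderiv ℝ p z v = ((fderiv ℝ p z 1 - Complex.I * fderiv ℝ p z Complex.I) * v).re := by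
  have hv : v = v.re • (1:ℂ) + v.im • Complex.I := by
    simp [Complex.re_add_im]
  conv_lhs => rw [hv]
  rw [map_add, map_smul, map_smul]
  simp
  ring

open Filter Topology Asymptotics in
theorem isLittleO_log_sub_log_pow {R : ℝ} (hR : 0 < R) (n : ℕ) :
    (fun z : ℂ => (log R - log ‖z‖) ^ n) =o[𝓝[≠] 0] fun z => z⁻¹ := by
  have h1 : Tendsto (fun z : ℂ => R * ‖z‖⁻¹) (𝓝[≠] 0) atTop :=
    (tendsto_inv_nhdsGT_zero.comp tendsto_norm_nhdsNE_zero).const_mul_atTop hR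
  have h2 := (isLittleO_pow_log_id_atTop (n := n)).comp_tendsto h1
  have h3 : (fun z : ℂ => R * ‖z‖⁻¹) =O[𝓝[≠] 0] fun z : ℂ => z⁻¹ := by
    refine IsBigO.of_bound R (Eventually.of_forall fun z => ?_)
    rw [norm_mul, norm_inv, norm_inv, norm_norm, norm_eq_abs, abs_of_pos hR]
  refine (h2.trans_isBigO h3).congr' ?_ EventuallyEq.rfl
  filter_upwards [self_mem_nhdsWithin] with z hz
  have : ‖z‖ ≠ 0 := norm_ne_zero_iff.2 hz
  simp only [Function.comp_apply]
  rw [log_mul hR.ne' (inv_ne_zero this), log_inv, sub_eq_add_neg]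

open InnerProductSpace Filter Topology Asymptotics in
/-- **Bôcher's theorem**: a positive harmonic function in a punctured disc is the sum of a multiple
of the logarithm and of a harmonic function in the disc. -/
theorem exists_eq_log_add_re_of_harmonicOnNhd_pos {p : ℂ → ℝ} {R : ℝ} (hR : 0 < R)
    (hp : HarmonicOnNhd p (ball 0 R \ {0})) (hpos : ∀ z ∈ ball 0 R \ {0}, 0 < p z) :
    ∃ a : ℝ, ∃ H : ℂ → ℂ, DifferentiableOn ℂ H (ball 0 R) ∧
      ∀ z ∈ ball (0:ℂ) R \ {0}, p z = a * log ‖z‖ + (H z).re := by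
  set V := ball (0:ℂ) R \ {0} with hV
  have hVo : IsOpen V := isOpen_ball_diff_zero R
  have h0 : (0:ℂ) ∈ ball (0:ℂ) R := mem_ball_self hR
  set g : ℂ → ℂ := fun z => fderiv ℝ p z 1 - Complex.I * fderiv ℝ p z Complex.I with hg
  set q : ℂ → ℂ := fun z => z * g z with hq
  obtain ⟨C, hC⟩ := exists_le_log_pow_of_harmonicOnNhd_punctured hR hp hpos
  have hqd : DifferentiableOn ℂ q V := fun z hz =>
    (differentiableAt_id.mul (HarmonicAt.differentiableAt_complex_partial (hp z hz))).differentiableWithinAt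
  have hqbound : ∀ z ∈ ball (0:ℂ) (R / 2) \ {0}, ‖q z‖ ≤ 8 * C * (log R - log ‖z‖) ^ 3 := by
    intro z hz
    have hzV : z ∈ V := ⟨ball_subset_ball (by linarith) hz.1, hz.2⟩
    have hzn : 0 < ‖z‖ := norm_pos_iff.2 hz.2
    have hL : 0 < log R - log ‖z‖ := sub_pos.2 (log_lt_log hzn (mem_ball_zero_iff.1 hzV.1))
    have hb : ∀ v : ℂ, ‖v‖ = 1 → |(q z * v).re| ≤ 4 * C * (log R - log ‖z‖) ^ 3 := by
      intro v hv
      have h1 := abs_fderiv_le_of_harmonicOnNhd_punctured hp hpos hzV v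
      rw [fderiv_apply_eq_re, hv, mul_one] at h1
      have h2 : q z * v = g z * (z * v) := by simp only [hq]; ring
      rw [h2]
      refine h1.trans ?_
      rw [div_le_iff₀ hL]
      have := hC z hz
      calc 4 * p z ≤ 4 * (C * (log R - log ‖z‖) ^ 4) := by linarith
        _ = _ := by ring
    have h3 := hb 1 (by simp)
    have h4 := hb (-Complex.I) (by simp)
    have h5 := Complex.norm_le_abs_re_add_abs_im (q z)
    simp at h3 h4
    linarith
  have ho : (fun z => q z - q 0) =o[𝓝[≠] 0] fun z => (z - 0)⁻¹ := by
    have hq0 : q 0 = 0 := by simp [hq]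
    simp only [hq0, sub_zero]
    refine IsBigO.trans_isLittleO ?_ (isLittleO_log_sub_log_pow hR 3)
    refine IsBigO.of_bound (8 * C) ?_
    have : ball (0:ℂ) (R / 2) \ {0} ∈ 𝓝[≠] (0:ℂ) :=
      sdiff_mem_nhdsWithin_compl (ball_mem_nhds _ (by positivity)) _
    filter_upwards [this] with z hz
    refine (hqbound z hz).trans ?_
    have hzn : 0 < ‖z‖ := norm_pos_iff.2 hz.2
    have hL : 0 < log R - log ‖z‖ :=
      sub_pos.2 (log_lt_log hzn ((mem_ball_zero_iff.1 hz.1).trans (by linarith)))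
    rw [norm_eq_abs, abs_of_pos (by positivity)]
  set Q := Function.update q 0 (limUnder (𝓝[≠] 0) q) with hQ
  have hQd : DifferentiableOn ℂ Q (ball 0 R) :=
    Complex.differentiableOn_update_limUnder_of_isLittleO (ball_mem_nhds _ hR) hqd ho
  have hGd : DifferentiableOn ℂ (dslope Q 0) (ball 0 R) :=
    (Complex.differentiableOn_dslope (ball_mem_nhds _ hR)).2 hQd
  obtain ⟨H, hH⟩ := hGd.isExactOn_ball
  set a := Q 0 with ha
  have hgz : ∀ z ∈ V, g z = a * z⁻¹ + dslope Q 0 z := by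
    intro z hz
    have hz0 : z ≠ 0 := hz.2
    have h1 := sub_smul_dslope Q 0 z
    rw [sub_zero, smul_eq_mul, hQ, Function.update_of_ne hz0, ← hQ, ← ha] at h1
    simp only [hq] at h1
    field_simp
    linear_combination -h1
  set r : ℂ → ℝ := fun z => p z - a.re * log ‖z‖ - (H z).re with hr
  have hrd : ∀ z ∈ V, HasFDerivAt r (Complex.reCLM.comp
      ((ContinuousLinearMap.toSpanSingleton ℂ (Complex.I * a.im * z⁻¹)).restrictScalars ℝ)) z := by
    intro z hz
    have h1 := ((hp z hz).1.differentiableAt (by norm_num)).hasFDerivAt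
    have h2 := (hasFDerivAt_log_norm hz.2).const_mul a.re
    have h3 := Complex.reCLM.hasFDerivAt.comp z ((hH z hz.1).hasFDerivAt.restrictScalars ℝ)
    refine ((h1.sub h2).sub h3).congr_fderiv ?_
    ext v
    have h4 := fderiv_apply_eq_re p z v
    change fderiv ℝ p z v = (g z * v).re at h4
    rw [hgz z hz] at h4
    have h5 : a = a.re + Complex.I * a.im := by
      rw [mul_comm]; exact (Complex.re_add_im a).symm
    have h6 : (a * z⁻¹ + dslope Q 0 z) * v =
        (a.re : ℂ) * (v * z⁻¹) + v * dslope Q 0 z + v * (Complex.I * a.im * z⁻¹) := by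
      linear_combination v * z⁻¹ * h5
    rw [h6, Complex.add_re, Complex.add_re, Complex.re_ofReal_mul] at h4
    simp only [sub_apply, smul_apply, ContinuousLinearMap.comp_apply,
      ContinuousLinearMap.coe_restrictScalars', ContinuousLinearMap.toSpanSingleton_apply,
      smul_eq_mul, Complex.reCLM_apply]
    rw [h4]
    ring
  have hpc : ContDiffOn ℝ 2 p V := hp.contDiffOn
  have him : a.im = 0 := by
    have hsph : sphere (0:ℂ) (R / 2) ⊆ V := by
      intro z hz
      rw [mem_sphere_zero_iff_norm] at hz
      refine ⟨by rw [mem_ball_zero_iff]; linarith, fun h => ?_⟩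
      rw [mem_singleton_iff] at h
      rw [h, norm_zero] at hz
      linarith
    have hrc : ContDiffOn ℝ 1 r V := by
      have hlog : ContDiffOn ℝ 1 (fun z : ℂ => log ‖z‖) V := fun z hz =>
        ((contDiffAt_norm ℝ (hz.2 : z ≠ 0)).log (norm_ne_zero_iff.2 hz.2)).contDiffWithinAt
      have hHd : DifferentiableOn ℂ H (ball 0 R) := fun z hz =>
        (hH z hz).differentiableAt.differentiableWithinAt
      have hHc : ContDiffOn ℝ 1 H (ball 0 R) :=
        (hHd.contDiffOn isOpen_ball).restrict_scalars ℝ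
      exact ((hpc.of_le (by norm_num)).sub (contDiffOn_const.mul hlog)).sub
        (Complex.reCLM.contDiff.comp_contDiffOn (hHc.mono sdiff_subset))
    have h1 := circleAverage_fderiv_angular hVo hrc (by positivity) hsph
    have h2 : circleAverage (fun z => fderiv ℝ r z (Complex.I * (z - 0))) 0 (R / 2) =
        circleAverage (fun _ => -a.im) 0 (R / 2) := by
      refine circleAverage_congr_sphere fun z hz => ?_
      rw [abs_of_pos (by positivity)] at hz
      have hz0 : z ≠ 0 := (hsph hz).2
      rw [(hrd z (hsph hz)).fderiv]
      simp only [ContinuousLinearMap.comp_apply,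
        ContinuousLinearMap.coe_restrictScalars', ContinuousLinearMap.toSpanSingleton_apply,
        smul_eq_mul, Complex.reCLM_apply, sub_zero]
      have h3 : Complex.I * z * (Complex.I * a.im * z⁻¹) = ((-a.im : ℝ) : ℂ) := by
        field_simp
        rw [Complex.I_sq]
        push_cast
        ring
      rw [h3, Complex.ofReal_re]
    rw [h2, circleAverage_const] at h1
    linarith
  obtain ⟨c, hc⟩ := hVo.exists_is_const_of_fderiv_eq_zero (isPreconnected_ball_diff_zero hR)
    (f := r) (𝕜 := ℝ) (fun z hz => (hrd z hz).differentiableAt.differentiableWithinAt)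
    (fun z hz => by
      rw [(hrd z hz).fderiv, him]
      ext v
      simp)
  refine ⟨a.re, fun z => H z + c, fun z hz =>
    ((hH z hz).differentiableAt.add_const _).differentiableWithinAt, fun z hz => ?_⟩
  have := hc z hz
  simp only [hr] at this
  rw [Complex.add_re, Complex.ofReal_re]
  linarith

open InnerProductSpace in
theorem setIntegral_ball_of_harmonicOnNhd {h : ℂ → ℝ} {c : ℂ} {ρ : ℝ}
    (hh : HarmonicOnNhd h (closedBall c ρ)) :
    ∫ z in ball c ρ, h z = h c * volume.real (ball c ρ) := by
  have hind : ∀ F : ℂ → ℝ, (fun z => (Iio ρ).indicator 1 ‖z - c‖ * F z) = (ball c ρ).indicator F := by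
    intro F
    ext z
    by_cases hz : ‖z - c‖ < ρ
    · rw [indicator_of_mem (by exact hz), indicator_of_mem (by rwa [mem_ball, dist_eq_norm])]
      simp
    · rw [indicator_of_notMem (by exact hz), indicator_of_notMem (by rwa [mem_ball, dist_eq_norm])]
      simp
  have hind1 : (fun z => (Iio ρ).indicator (1 : ℝ → ℝ) ‖z - c‖) =
      (ball c ρ).indicator fun _ => (1:ℝ) := by
    rw [← hind]
    simp
  have hc : IntegrableOn h (ball c ρ) :=
    ((HarmonicOnNhd.continuousOn hh).integrableOn_compact (isCompact_closedBall _ _)).mono_set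
      ball_subset_closedBall
  have hm := integral_radial_mul_eq (F := h) (k := (Iio ρ).indicator 1) (c := c) (m := h c)
    (by rw [hind]; exact hc.integrable_indicator measurableSet_ball)
    (by rw [hind1]; exact (integrableOn_const measure_ball_lt_top.ne).integrable_indicator
          measurableSet_ball)
    (fun r hr hkr => by
      have hrρ : r < ρ := by
        by_contra hcon
        exact hkr (indicator_of_notMem (by exact hcon) _)
      refine InnerProductSpace.HarmonicOnNhd.circleAverage_eq (HarmonicOnNhd.mono hh ?_)
      rw [abs_of_pos hr]
      exact closedBall_subset_closedBall hrρ.le)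
  rw [hind, hind1, integral_indicator measurableSet_ball, integral_indicator measurableSet_ball] at hm
  rw [hm]
  simp

open InnerProductSpace in
/-- The exponential of a harmonic function satisfies the sub-mean value property. -/
theorem exp_mul_le_setIntegral_exp {h : ℂ → ℝ} {c : ℂ} {ρ : ℝ}
    (hh : HarmonicOnNhd h (closedBall c ρ)) :
    exp (h c) * volume.real (ball c ρ) ≤ ∫ z in ball c ρ, exp (h z) := by
  have hcont := HarmonicOnNhd.continuousOn hh
  have hc : IntegrableOn h (ball c ρ) :=
    (hcont.integrableOn_compact (isCompact_closedBall _ _)).mono_set ball_subset_closedBall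
  have hce : IntegrableOn (fun z => exp (h z)) (ball c ρ) :=
    ((continuous_exp.comp_continuousOn hcont).integrableOn_compact
      (isCompact_closedBall _ _)).mono_set ball_subset_closedBall
  have h1 : IntegrableOn (fun _ : ℂ => (1 - h c)) (ball c ρ) :=
    integrableOn_const measure_ball_lt_top.ne
  calc exp (h c) * volume.real (ball c ρ)
      = ∫ z in ball c ρ, exp (h c) * (h z + (1 - h c)) := by
        rw [integral_const_mul, integral_add hc h1, setIntegral_ball_of_harmonicOnNhd hh,
          setIntegral_const, smul_eq_mul]
        ring
    _ ≤ ∫ z in ball c ρ, exp (h z) := by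
        refine setIntegral_mono ((hc.add h1).const_mul _) hce fun z => ?_
        have := add_one_le_exp (h z - h c)
        rw [← add_sub_cancel (h c) (h z), exp_add]
        refine mul_le_mul_of_nonneg_left ?_ (exp_pos _).le
        linarith

open InnerProductSpace in
theorem exists_eq_log_add_re_of_integrableOn_exp {h : ℂ → ℝ} {R : ℝ} (hR : 0 < R)
    (hh : HarmonicOnNhd h (ball 0 R \ {0}))
    (hint : IntegrableOn (fun z => exp (h z)) (ball 0 R \ {0})) :
    ∃ b : ℝ, ∃ H : ℂ → ℂ, DifferentiableOn ℂ H (ball 0 (R / 2)) ∧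
      ∀ z ∈ ball 0 (R / 2) \ {0}, h z = b * log ‖z‖ + (H z).re := by
  set A := ∫ z in ball 0 R \ {0}, exp (h z) with hA
  have hgrowth : ∀ x ∈ ball (0:ℂ) (R / 2) \ {0}, h x ≤ log A - log (π / 4) - 2 * log ‖x‖ := by
    rintro x ⟨hx, hx0⟩
    have hxn : 0 < ‖x‖ := norm_pos_iff.2 hx0
    rw [mem_ball_zero_iff] at hx
    have hsub : closedBall x (‖x‖ / 2) ⊆ ball 0 R \ {0} := by
      intro z hz
      rw [mem_closedBall, dist_eq_norm] at hz
      have h1 : ‖z‖ ≤ ‖x‖ + ‖z - x‖ := by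
        simpa using norm_add_le x (z - x)
      refine ⟨by rw [mem_ball_zero_iff]; linarith, fun h0 => ?_⟩
      rw [mem_singleton_iff] at h0
      rw [h0, zero_sub, norm_neg] at hz
      linarith
    have h1 := exp_mul_le_setIntegral_exp (HarmonicOnNhd.mono hh hsub)
    have h2 : ∫ z in ball x (‖x‖ / 2), exp (h z) ≤ A :=
      setIntegral_mono_set hint (ae_of_all _ fun z => (exp_pos _).le)
        (ae_of_all _ (ball_subset_closedBall.trans hsub))
    have h3 : volume.real (ball x (‖x‖ / 2)) = π / 4 * ‖x‖ ^ 2 := by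
      rw [Measure.real, Complex.volume_ball]
      simp only [ENNReal.toReal_mul, ENNReal.toReal_pow, ENNReal.coe_toReal, NNReal.coe_real_pi]
      rw [ENNReal.toReal_ofReal (by positivity)]
      ring
    rw [h3] at h1
    have h4 := log_le_log (by positivity) (h1.trans h2)
    rw [log_mul (exp_pos _).ne' (by positivity), log_exp, log_mul (by positivity) (by positivity),
      log_pow] at h4
    push_cast at h4
    linarith
  obtain ⟨a, H, hH, heq⟩ := exists_eq_log_add_re_of_harmonicOnNhd_pos (half_pos hR)
    (p := fun z => (log A - log (π / 4) + 1) - (2:ℝ) • log ‖z‖ - h z) (fun z hz => by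
      refine HarmonicAt.sub (HarmonicAt.sub (harmonicAt_const _) (HarmonicAt.const_smul ?_)) ?_
      · exact analyticAt_id.harmonicAt_log_norm hz.2
      · exact hh z ⟨ball_subset_ball (by linarith) hz.1, hz.2⟩)
    (fun z hz => by
      have := hgrowth z hz
      simp only [smul_eq_mul]
      linarith)
  refine ⟨-2 - a, fun z => ((log A - log (π / 4) + 1 : ℝ) : ℂ) - H z,
    (differentiableOn_const _).sub hH, fun z hz => ?_⟩
  have := heq z hz
  simp only [smul_eq_mul] at this
  rw [Complex.sub_re, Complex.ofReal_re]
  linarith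

theorem integrableOn_norm_rpow_ball_iff {s r : ℝ} (hr : 0 < r) :
    IntegrableOn (fun z : ℂ => ‖z‖ ^ s) (ball 0 r) ↔ -2 < s := by
  rw [integrableOn_fun_norm_addHaar volume (f := fun t => t ^ s), Complex.finrank_real_complex]
  have h : EqOn (fun y : ℝ => y ^ (2 - 1) • y ^ s) (fun y => y ^ (s + 1)) (Ioo 0 r) := by
    intro y hy
    simp only [smul_eq_mul]
    rw [rpow_add_one hy.1.ne', pow_one, mul_comm]
  rw [integrableOn_congr_fun h measurableSet_Ioo, intervalIntegral.integrableOn_Ioo_rpow_iff hr]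
  constructor <;> intro h <;> linarith

theorem neg_two_lt_of_integrableOn_exp {h : ℂ → ℝ} {R b : ℝ} {H : ℂ → ℂ} (hR : 0 < R)
    (hH : DifferentiableOn ℂ H (ball 0 R)) (heq : ∀ z ∈ ball 0 R \ {0}, h z = b * log ‖z‖ + (H z).re)
    (hint : IntegrableOn (fun z => exp (h z)) (ball 0 R \ {0})) : -2 < b := by
  have hsub : closedBall (0:ℂ) (R / 2) ⊆ ball 0 R := closedBall_subset_ball (by linarith)
  obtain ⟨C, hC⟩ := (isCompact_closedBall (0:ℂ) (R / 2)).exists_bound_of_continuousOn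
    (hH.continuousOn.mono hsub)
  rw [← integrableOn_norm_rpow_ball_iff (half_pos hR)]
  have hae : (ball (0:ℂ) (R / 2) \ {0} : Set ℂ) =ᵐ[volume] ball (0:ℂ) (R / 2) :=
    sdiff_null_ae_eq_self (measure_singleton 0)
  refine IntegrableOn.congr_set_ae ?_ hae.symm
  have h1 : IntegrableOn (fun z => exp C * exp (h z)) (ball 0 (R / 2) \ {0}) :=
    (hint.mono_set (sdiff_subset_sdiff_left (ball_subset_closedBall.trans hsub))).const_mul _
  refine h1.mono' (measurable_norm.pow_const b).aestronglyMeasurable ?_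
  refine (ae_restrict_iff' (isOpen_ball_diff_zero _).measurableSet).2 (ae_of_all _ fun z hz => ?_)
  have hz0 : 0 < ‖z‖ := norm_pos_iff.2 hz.2
  have hzC := (Complex.abs_re_le_norm _).trans (hC z (ball_subset_closedBall hz.1))
  rw [norm_of_nonneg (by positivity), ← exp_add,
    heq z ⟨hsub (ball_subset_closedBall hz.1), hz.2⟩, rpow_def_of_pos hz0]
  refine exp_le_exp.2 ?_
  have := neg_abs_le (H z).re
  nlinarith

/-- An exponential form of Jensen's inequality for measures of small mass. -/
theorem exp_integral_mul_le {f g : ℂ → ℝ} {τ : ℝ} (hτ : 0 < τ) (hf : ∀ z, 0 ≤ f z)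
    (hg : ∀ z, 0 ≤ g z) (hgi : Integrable g) (hfg : Integrable fun z => f z * g z)
    (he : Integrable fun z => exp (τ * f z) * g z) (hm : ∫ z, g z ≤ τ) :
    exp (∫ z, f z * g z) ≤ 1 + τ⁻¹ * ∫ z, exp (τ * f z) * g z := by
  set I := ∫ z, f z * g z with hI
  set m := ∫ z, g z with hmdef
  have hI0 : 0 ≤ I := integral_nonneg fun z => mul_nonneg (hf z) (hg z)
  have hm0 : 0 ≤ m := integral_nonneg hg
  have h1 : exp I * (τ * I + (1 - I) * m) ≤ ∫ z, exp (τ * f z) * g z := by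
    have h2 : exp I * (τ * I + (1 - I) * m) =
        ∫ z, exp I * (τ * (f z * g z) + (1 - I) * g z) := by
      rw [integral_const_mul, integral_add (hfg.const_mul _) (hgi.const_mul _),
        integral_const_mul, integral_const_mul]
    rw [h2]
    refine integral_mono (((hfg.const_mul _).add (hgi.const_mul _)).const_mul _) he fun z => ?_
    have h3 := add_one_le_exp (τ * f z - I)
    have h4 : exp (τ * f z) = exp I * exp (τ * f z - I) := by
      rw [← exp_add]; congr 1; ring
    simp only
    rw [h4, mul_assoc]
    refine mul_le_mul_of_nonneg_left ?_ (exp_pos _).le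
    nlinarith [mul_le_mul_of_nonneg_right h3 (hg z)]
  have h5 : τ * exp I - τ ≤ ∫ z, exp (τ * f z) * g z := by
    refine le_trans ?_ h1
    rcases le_total I 1 with h | h
    · have h6 := add_one_le_exp (-I)
      have h7 : exp I * exp (-I) = 1 := by rw [← exp_add]; simp
      have h8 : 0 ≤ (1 - I) * m * exp I := by
        have : 0 ≤ 1 - I := by linarith
        positivity
      have h9 := mul_le_mul_of_nonneg_left h6 (exp_pos I).le
      nlinarith [mul_le_mul_of_nonneg_left h9 hτ.le]
    · have h6 : (1 - I) * τ ≤ (1 - I) * m := by nlinarith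
      have h7 := mul_le_mul_of_nonneg_left h6 (exp_pos I).le
      nlinarith
  have h6 : exp I - 1 = τ⁻¹ * (τ * exp I - τ) := by field_simp
  have := mul_le_mul_of_nonneg_left h5 (inv_pos.2 hτ).le
  linarith

theorem rpow_neg_mul_rpow_neg_le {a c p q : ℝ} (ha : 0 ≤ a) (hc : 0 ≤ c) (hp : 0 < p) (hq : 0 < q) :
    a ^ (-p) * c ^ (-q) ≤ a ^ (-(p + q)) + c ^ (-(p + q)) := by
  rcases ha.eq_or_lt with rfl | ha
  · rw [zero_rpow (by linarith), zero_mul]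
    positivity
  rcases hc.eq_or_lt with rfl | hc
  · rw [zero_rpow (by linarith), mul_zero]
    positivity
  rw [neg_add, rpow_add ha, rpow_add hc]
  rcases le_total a c with h | h
  · have := rpow_le_rpow_of_nonpos ha h (by linarith : -q ≤ 0)
    have := mul_le_mul_of_nonneg_left this (rpow_nonneg ha.le (-p))
    have : 0 ≤ c ^ (-p) * c ^ (-q) := by positivity
    linarith
  · have := rpow_le_rpow_of_nonpos hc h (by linarith : -p ≤ 0)
    have := mul_le_mul_of_nonneg_right this (rpow_nonneg hc.le (-q))
    have : 0 ≤ a ^ (-p) * a ^ (-q) := by positivity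
    linarith

theorem log_one_add_le_rpow_div {t σ : ℝ} (ht : 0 ≤ t) (hσ : 0 < σ) (hσ1 : σ ≤ 1) :
    log (1 + t) ≤ σ⁻¹ * t ^ σ := by
  have h1 : (1 + t) ^ σ ≤ 1 + t ^ σ := by
    simpa using Real.rpow_add_le_add_rpow zero_le_one ht hσ.le hσ1
  have h2 : σ * log (1 + t) ≤ t ^ σ := by
    rw [← log_rpow (by linarith)]
    have := log_le_sub_one_of_pos (x := (1 + t) ^ σ) (by positivity)
    linarith
  rw [← le_div_iff₀' hσ] at h2
  rwa [inv_mul_eq_div]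

theorem abs_log_sub_log_le {a c σ : ℝ} (ha : 0 < a) (hc : 0 < c) (hσ : 0 < σ) (hσ1 : σ ≤ 1) :
    |log a - log c| ≤ σ⁻¹ * |a - c| ^ σ * (a ^ (-σ) + c ^ (-σ)) := by
  wlog h : a ≤ c generalizing a c
  · rw [abs_sub_comm, abs_sub_comm a c, add_comm]
    exact this hc ha (le_of_not_ge h)
  have h1 := log_one_add_le_rpow_div (t := (c - a) / a) (div_nonneg (by linarith) ha.le) hσ hσ1
  have h2 : 1 + (c - a) / a = c / a := by field_simp; ring
  have h3 : 0 ≤ c - a := by linarith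
  rw [h2, log_div hc.ne' ha.ne', div_rpow h3 ha.le, div_eq_mul_inv, ← rpow_neg ha.le] at h1
  have h4 : log a ≤ log c := log_le_log ha h
  rw [abs_of_nonpos (by linarith), abs_of_nonpos (by linarith : a - c ≤ 0), neg_sub, neg_sub]
  refine h1.trans ?_
  rw [← mul_assoc]
  exact mul_le_mul_of_nonneg_left (le_add_of_nonneg_right (by positivity)) (by positivity)

theorem posLog_one_div_le_rpow {t σ : ℝ} (ht : 0 ≤ t) (hσ : 0 < σ) :
    log⁺ (1 / t) ≤ σ⁻¹ * t ^ (-σ) := by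
  rcases ht.eq_or_lt with rfl | ht
  · simp only [div_zero, posLog_zero]
    positivity
  change max 0 (log (1 / t)) ≤ _
  refine max_le (by positivity) ?_
  have h := log_le_sub_one_of_pos (x := t ^ (-σ)) (by positivity)
  rw [log_rpow ht] at h
  rw [one_div, log_inv, inv_mul_eq_div, le_div_iff₀ hσ]
  linarith

theorem exp_mul_posLog_one_div_le {t τ : ℝ} (ht : 0 ≤ t) :
    exp (τ * log⁺ (1 / t)) ≤ 1 + t ^ (-τ) := by
  change exp (τ * max 0 (log (1 / t))) ≤ _
  rcases le_total (log (1 / t)) 0 with h | h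
  · rw [max_eq_left h, mul_zero, exp_zero]
    have : 0 ≤ t ^ (-τ) := by positivity
    linarith
  · rcases ht.eq_or_lt with rfl | ht
    · simp only [div_zero, log_zero, max_self, mul_zero, exp_zero]
      have : 0 ≤ (0:ℝ) ^ (-τ) := by positivity
      linarith
    rw [max_eq_right h, one_div, log_inv, rpow_def_of_pos ht, mul_neg, mul_neg, mul_comm]
    linarith

/-- The Riesz kernel `‖z‖ ^ (-κ)`, as an extended nonnegative number. -/
def rieszKernel (κ : ℝ) (z : ℂ) : ℝ≥0∞ := ENNReal.ofReal (‖z‖ ^ (-κ))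

theorem measurable_rieszKernel (κ : ℝ) : Measurable (rieszKernel κ) :=
  (measurable_norm.pow_const _).ennreal_ofReal

theorem rieszKernel_mul_le {p q : ℝ} (hp : 0 < p) (hq : 0 < q) (x y : ℂ) :
    rieszKernel p x * rieszKernel q y ≤ rieszKernel (p + q) x + rieszKernel (p + q) y := by
  rw [rieszKernel, rieszKernel, rieszKernel, rieszKernel, ← ENNReal.ofReal_mul (by positivity),
    ← ENNReal.ofReal_add (by positivity) (by positivity)]
  exact ENNReal.ofReal_le_ofReal
    (rpow_neg_mul_rpow_neg_le (norm_nonneg _) (norm_nonneg _) hp hq)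

theorem exists_setLIntegral_rieszKernel_le {κ : ℝ} (hκ0 : 0 < κ) (hκ : κ < 2) :
    ∃ L : ℝ≥0∞, L ≠ ∞ ∧ ∀ x : ℂ, ∫⁻ y in ball 0 1, rieszKernel κ (x - y) ≤ L := by
  refine ⟨volume (ball (0:ℂ) 1) + ∫⁻ y in ball 0 1, rieszKernel κ y, ?_, fun x => ?_⟩
  · refine ENNReal.add_ne_top.2 ⟨measure_ball_lt_top.ne, ?_⟩
    exact ((integrableOn_norm_rpow_ball_iff one_pos).2 (by linarith : -2 < -κ)).lintegral_lt_top.ne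
  · have h : ∀ y : ℂ, rieszKernel κ y ≤ 1 + (ball (0:ℂ) 1).indicator (rieszKernel κ) y := by
      intro y
      by_cases hy : y ∈ ball (0:ℂ) 1
      · rw [indicator_of_mem hy]
        exact le_add_self
      · rw [indicator_of_notMem hy, add_zero, rieszKernel, ENNReal.ofReal_le_one]
        rw [mem_ball_zero_iff, not_lt] at hy
        exact rpow_le_one_of_one_le_of_nonpos hy (by linarith)
    calc ∫⁻ y in ball 0 1, rieszKernel κ (x - y)
        ≤ ∫⁻ y in ball 0 1, (1 + (ball (0:ℂ) 1).indicator (rieszKernel κ) (x - y)) :=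
          lintegral_mono fun y => h _
      _ = volume (ball (0:ℂ) 1) +
          ∫⁻ y in ball 0 1, (ball (0:ℂ) 1).indicator (rieszKernel κ) (x - y) := by
          rw [lintegral_add_left measurable_const]
          simp
      _ ≤ volume (ball (0:ℂ) 1) + ∫⁻ y, (ball (0:ℂ) 1).indicator (rieszKernel κ) (x - y) := by
          exact add_le_add_right (setLIntegral_le_lintegral _ _) _
      _ = _ := by
          rw [lintegral_sub_left_eq_self (fun y => (ball (0:ℂ) 1).indicator (rieszKernel κ) y) x,
            lintegral_indicator measurableSet_ball]

/-- Uniform bound for iterated Riesz kernels of subcritical total order. -/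
theorem exists_setLIntegral_rieszKernel_mul_le (ν : Measure ℂ) [IsFiniteMeasure ν] {σ s τ : ℝ}
    (hσ : 0 < σ) (hs : 0 < s) (hτ : 0 < τ) (h2 : σ + s + τ < 2) :
    ∃ S : ℝ≥0∞, S ≠ ∞ ∧ ∀ z : ℂ, ∫⁻ y in ball 0 1, rieszKernel σ (z - y) * rieszKernel s y *
      (1 + ∫⁻ v, rieszKernel τ (y - v) ∂ν) ≤ S := by
  obtain ⟨L₁, hL₁, h₁⟩ := exists_setLIntegral_rieszKernel_le (κ := σ + s) (by linarith) (by linarith)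
  obtain ⟨L₂, hL₂, h₂⟩ := exists_setLIntegral_rieszKernel_le (κ := σ + s + τ) (by linarith) h2
  have hneg : ∀ (κ : ℝ) (x : ℂ), rieszKernel κ (-x) = rieszKernel κ x := fun κ x => by
    rw [rieszKernel, norm_neg, rieszKernel]
  have hm : ∀ (κ : ℝ) (x : ℂ), Measurable fun y : ℂ => rieszKernel κ (x - y) := fun κ x =>
    (measurable_rieszKernel κ).comp (measurable_const.sub measurable_id)
  refine ⟨(L₁ + L₁) + ((L₂ + L₂) + (L₂ + L₂)) * ν univ, by finiteness, fun z => ?_⟩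
  have e0 : ∀ κ : ℝ, ∀ y, rieszKernel κ y = rieszKernel κ (0 - y) := fun κ y => by
    rw [zero_sub, hneg]
  have hA : ∫⁻ y in ball 0 1, rieszKernel σ (z - y) * rieszKernel s y ≤ L₁ + L₁ := by
    calc ∫⁻ y in ball 0 1, rieszKernel σ (z - y) * rieszKernel s y
        ≤ ∫⁻ y in ball 0 1, (rieszKernel (σ + s) (z - y) + rieszKernel (σ + s) (0 - y)) :=
          lintegral_mono fun y => (rieszKernel_mul_le hσ hs _ _).trans_eq (by rw [← e0])
      _ ≤ L₁ + L₁ := by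
          rw [lintegral_add_left (hm _ _)]
          exact add_le_add (h₁ _) (h₁ _)
  have hm3 : ∀ x x' : ℂ, Measurable fun y : ℂ =>
      rieszKernel (σ + s + τ) (x - y) + rieszKernel (σ + s + τ) (x' - y) := fun x x' =>
    (hm _ x).add (hm _ x')
  have hB : ∀ v : ℂ, ∫⁻ y in ball 0 1, rieszKernel σ (z - y) * rieszKernel s y *
      rieszKernel τ (y - v) ≤ (L₂ + L₂) + (L₂ + L₂) := by
    intro v
    calc ∫⁻ y in ball 0 1, rieszKernel σ (z - y) * rieszKernel s y * rieszKernel τ (y - v)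
        ≤ ∫⁻ y in ball 0 1, ((rieszKernel (σ + s + τ) (z - y) + rieszKernel (σ + s + τ) (v - y)) +
          (rieszKernel (σ + s + τ) (0 - y) + rieszKernel (σ + s + τ) (v - y))) := by
          refine lintegral_mono fun y => ?_
          have e1 : rieszKernel τ (y - v) = rieszKernel τ (v - y) := by rw [← hneg, neg_sub]
          calc _ ≤ (rieszKernel (σ + s) (z - y) + rieszKernel (σ + s) y) *
                rieszKernel τ (y - v) := by
                gcongr
                exact rieszKernel_mul_le hσ hs _ _
            _ ≤ _ := by
                rw [add_mul, e1, e0 _ y]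
                exact add_le_add (rieszKernel_mul_le (by linarith) hτ _ _)
                  (rieszKernel_mul_le (by linarith) hτ _ _)
      _ ≤ (L₂ + L₂) + (L₂ + L₂) := by
          rw [lintegral_add_left (hm3 z v), lintegral_add_left (hm _ _),
            lintegral_add_left (hm _ _)]
          exact add_le_add (add_le_add (h₂ _) (h₂ _)) (add_le_add (h₂ _) (h₂ _))
  have hm2 : Measurable fun y : ℂ => rieszKernel σ (z - y) * rieszKernel s y :=
    (hm _ _).mul (measurable_rieszKernel s)
  simp only [mul_add, mul_one]
  rw [lintegral_add_left hm2]
  refine add_le_add hA ?_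
  calc ∫⁻ y in ball 0 1, rieszKernel σ (z - y) * rieszKernel s y * ∫⁻ v, rieszKernel τ (y - v) ∂ν
      = ∫⁻ y in ball 0 1, ∫⁻ v, rieszKernel σ (z - y) * rieszKernel s y *
          rieszKernel τ (y - v) ∂ν := by
        refine lintegral_congr fun y => ?_
        rw [lintegral_const_mul]
        exact (measurable_rieszKernel τ).comp (measurable_const.sub measurable_id)
    _ = ∫⁻ v, (∫⁻ y in ball 0 1, rieszKernel σ (z - y) * rieszKernel s y *
          rieszKernel τ (y - v)) ∂ν := by
        refine lintegral_lintegral_swap (Measurable.aemeasurable ?_)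
        exact (hm2.comp measurable_fst).mul
          ((measurable_rieszKernel τ).comp (measurable_fst.sub measurable_snd))
    _ ≤ ∫⁻ _, (L₂ + L₂) + (L₂ + L₂) ∂ν := lintegral_mono hB
    _ = _ := lintegral_const _

theorem exp_logPotential_le {g : ℂ → ℝ} (hg : Integrable g) (hg0 : ∀ z, 0 ≤ g z) {τ R : ℝ}
    (hτ : 0 < τ) (hR : 0 < R) (hm : ∫ z in ball 0 R, g z ≤ τ) {y : ℂ} (hy : y ∈ ball 0 (R / 2))
    (hJ : Integrable fun v => ‖y - v‖ ^ (-τ) * g v) :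
    exp (logPotential g y) ≤
      exp (log⁺ (2 / R) * ∫ v, g v) * (2 + τ⁻¹ * ∫ v, ‖y - v‖ ^ (-τ) * g v) := by
  set gR := (ball (0:ℂ) R).indicator g with hgR
  have hgRi : Integrable gR := hg.indicator measurableSet_ball
  have hgR0 : ∀ z, 0 ≤ gR z := fun z => indicator_nonneg (fun z _ => hg0 z) z
  have hgRle : ∀ z, gR z ≤ g z := fun z => indicator_le_self' (fun z _ => hg0 z) z
  have hk : Measurable fun v : ℂ => log⁺ (1 / ‖y - v‖) := by
    simp only [posLog_def]
    exact measurable_const.max (measurable_log.comp (by fun_prop))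
  have hkle : ∀ v, log⁺ (1 / ‖y - v‖) ≤ τ⁻¹ * ‖y - v‖ ^ (-τ) := fun v =>
    posLog_one_div_le_rpow (norm_nonneg _) hτ
  have hki : Integrable fun v => log⁺ (1 / ‖y - v‖) * gR v := by
    refine (hJ.const_mul τ⁻¹).mono' (hk.aestronglyMeasurable.mul hgRi.aestronglyMeasurable)
      (ae_of_all _ fun v => ?_)
    rw [norm_of_nonneg (mul_nonneg posLog_nonneg (hgR0 v)), ← mul_assoc]
    exact mul_le_mul (hkle v) (hgRle v) (hgR0 v) (posLog_nonneg.trans (hkle v))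
  have hele : ∀ v, exp (τ * log⁺ (1 / ‖y - v‖)) * gR v ≤ gR v + ‖y - v‖ ^ (-τ) * g v := by
    intro v
    have h1 := mul_le_mul_of_nonneg_right
      (exp_mul_posLog_one_div_le (τ := τ) (norm_nonneg (y - v))) (hgR0 v)
    have h2 := mul_le_mul_of_nonneg_left (hgRle v)
      (rpow_nonneg (norm_nonneg (y - v)) (-τ))
    linarith
  have hei : Integrable fun v => exp (τ * log⁺ (1 / ‖y - v‖)) * gR v := by
    refine (hgRi.add hJ).mono' ((hk.const_mul τ).exp.aestronglyMeasurable.mul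
      hgRi.aestronglyMeasurable) (ae_of_all _ fun v => ?_)
    rw [norm_of_nonneg (mul_nonneg (exp_pos _).le (hgR0 v))]
    exact hele v
  have hmR : ∫ z, gR z ≤ τ := by rwa [hgR, integral_indicator measurableSet_ball]
  have h1 := exp_integral_mul_le hτ (fun v => posLog_nonneg) hgR0 hgRi hki hei hmR
  have h2 : ∫ v, exp (τ * log⁺ (1 / ‖y - v‖)) * gR v ≤ τ + ∫ v, ‖y - v‖ ^ (-τ) * g v := by
    refine (integral_mono hei (hgRi.add hJ) hele).trans ?_
    rw [integral_add' hgRi hJ]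
    linarith
  have h3 : logPotential g y ≤
      log⁺ (2 / R) * (∫ v, g v) + ∫ v, log⁺ (1 / ‖y - v‖) * gR v := by
    rw [← integral_const_mul, ← integral_add (hg.const_mul _) hki, logPotential]
    refine integral_mono_of_nonneg (ae_of_all _ fun v => mul_nonneg posLog_nonneg (hg0 v))
      ((hg.const_mul _).add hki) (ae_of_all _ fun v => ?_)
    simp only
    by_cases hv : v ∈ ball (0:ℂ) R
    · rw [hgR, indicator_of_mem hv]
      have := mul_nonneg (posLog_nonneg (x := 2 / R)) (hg0 v)
      linarith
    · rw [hgR, indicator_of_notMem hv, mul_zero, add_zero]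
      refine mul_le_mul_of_nonneg_right (posLog_le_posLog (by positivity) ?_) (hg0 v)
      rw [mem_ball_zero_iff] at hv hy
      have h4 : R / 2 ≤ ‖y - v‖ := by
        have := norm_sub_norm_le v y
        rw [norm_sub_rev]
        linarith
      rw [div_le_div_iff₀ (by linarith) hR]
      linarith
  refine (exp_le_exp.2 h3).trans ?_
  rw [exp_add]
  refine mul_le_mul_of_nonneg_left (h1.trans ?_) (exp_pos _).le
  have h4 := mul_le_mul_of_nonneg_left h2 (inv_pos.2 hτ).le
  rw [mul_add, inv_mul_cancel₀ hτ.ne'] at h4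
  linarith

theorem exists_lintegral_rieszKernel_mul_le {g : ℂ → ℝ} (hg : Integrable g) (hg0 : ∀ z, 0 ≤ g z)
    {σ s τ R C : ℝ} (hσ : 0 < σ) (hs : 0 < s) (hτ : 0 < τ) (h2 : σ + s + τ < 2) (hR : 0 < R)
    (hR1 : R ≤ 1) (hC : 0 < C) (hm : ∫ z in ball 0 R, g z ≤ τ)
    (hgC : ∀ z ∈ ball (0:ℂ) (R / 2) \ {0}, g z ≤ C * ‖z‖ ^ (-s) * exp (logPotential g z)) :
    ∃ S : ℝ≥0∞, S ≠ ∞ ∧ ∀ z ∈ ball (0:ℂ) (R / 4),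
      ∫⁻ y, rieszKernel σ (z - y) * ENNReal.ofReal (g y) ≤ S := by
  set ν : Measure ℂ := volume.withDensity fun y => ENNReal.ofReal (g y) with hν
  have hgl : ∫⁻ y, ENNReal.ofReal (g y) ≠ ∞ := hg.lintegral_lt_top.ne
  have : IsFiniteMeasure ν := isFiniteMeasure_withDensity hgl
  have hgm : AEMeasurable (fun y => ENNReal.ofReal (g y)) := hg.aemeasurable.ennreal_ofReal
  have hm' : ∀ (κ : ℝ) (x : ℂ), Measurable fun y : ℂ => rieszKernel κ (x - y) := fun κ x =>
    (measurable_rieszKernel κ).comp (measurable_const.sub measurable_id)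
  have hm0 : ∀ y : ℂ, Measurable fun v : ℂ => ‖y - v‖ ^ (-τ) := fun y => by fun_prop
  obtain ⟨S, hS, hSb⟩ := exists_setLIntegral_rieszKernel_mul_le ν hσ hs hτ h2
  set A := C * exp (log⁺ (2 / R) * ∫ v, g v) * (2 + τ⁻¹) with hA
  have hA0 : 0 < A := by positivity
  have hpt : ∀ y ∈ ball (0:ℂ) (R / 2) \ {0}, ENNReal.ofReal (g y) ≤
      ENNReal.ofReal A * (rieszKernel s y * (1 + ∫⁻ v, rieszKernel τ (y - v) ∂ν)) := by
    intro y hy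
    have hy0 : 0 < ‖y‖ := norm_pos_iff.2 hy.2
    have hlν : ∫⁻ v, rieszKernel τ (y - v) ∂ν =
        ∫⁻ v, ENNReal.ofReal (‖y - v‖ ^ (-τ) * g v) := by
      rw [hν, lintegral_withDensity_eq_lintegral_mul₀ hgm (hm' τ y).aemeasurable]
      refine lintegral_congr fun v => ?_
      rw [Pi.mul_apply, rieszKernel, mul_comm, ENNReal.ofReal_mul (by positivity)]
    have h0 : ∀ v, 0 ≤ ‖y - v‖ ^ (-τ) * g v := fun v => mul_nonneg (by positivity) (hg0 v)
    by_cases htop : ∫⁻ v, rieszKernel τ (y - v) ∂ν = ∞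
    · have h1 : rieszKernel s y ≠ 0 := (ENNReal.ofReal_pos.2 (by positivity)).ne'
      rw [htop, add_top, ENNReal.mul_top h1, ENNReal.mul_top (ENNReal.ofReal_pos.2 hA0).ne']
      exact le_top
    · rw [hlν] at htop ⊢
      have hJ : Integrable fun v => ‖y - v‖ ^ (-τ) * g v :=
        ⟨(hm0 y).aestronglyMeasurable.mul hg.aestronglyMeasurable, by
          rw [hasFiniteIntegral_iff_ofReal (ae_of_all _ h0)]
          exact lt_top_iff_ne_top.2 htop⟩
      rw [← ofReal_integral_eq_lintegral_ofReal hJ (ae_of_all _ h0), rieszKernel,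
        ← ENNReal.ofReal_one, ← ENNReal.ofReal_add zero_le_one (integral_nonneg h0),
        ← ENNReal.ofReal_mul (by positivity), ← ENNReal.ofReal_mul hA0.le]
      refine ENNReal.ofReal_le_ofReal ((hgC y hy).trans ?_)
      have h1 := exp_logPotential_le hg hg0 hτ hR hm hy.1 hJ
      have hJ0 : 0 ≤ ∫ v, ‖y - v‖ ^ (-τ) * g v := integral_nonneg h0
      set J := ∫ v, ‖y - v‖ ^ (-τ) * g v
      have h3 : 2 + τ⁻¹ * J ≤ (2 + τ⁻¹) * (1 + J) := by
        have : 0 < τ⁻¹ := by positivity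
        nlinarith
      calc C * ‖y‖ ^ (-s) * exp (logPotential g y)
          ≤ C * ‖y‖ ^ (-s) * (exp (log⁺ (2 / R) * ∫ v, g v) * ((2 + τ⁻¹) * (1 + J))) := by
            refine mul_le_mul_of_nonneg_left (h1.trans ?_) (by positivity)
            exact mul_le_mul_of_nonneg_left h3 (exp_pos _).le
        _ = A * (‖y‖ ^ (-s) * (1 + J)) := by rw [hA]; ring
  refine ⟨ENNReal.ofReal A * S + ENNReal.ofReal ((R / 4) ^ (-σ)) * ∫⁻ y, ENNReal.ofReal (g y),
    by finiteness, fun z hz => ?_⟩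
  rw [mem_ball_zero_iff] at hz
  rw [← lintegral_add_compl _ (measurableSet_ball : MeasurableSet (ball (0:ℂ) (R / 2)))]
  refine add_le_add ?_ ?_
  · have hae : ∀ᵐ y : ℂ, y ≠ 0 := compl_mem_ae_iff.2 (measure_singleton 0)
    calc ∫⁻ y in ball 0 (R / 2), rieszKernel σ (z - y) * ENNReal.ofReal (g y)
        ≤ ∫⁻ y in ball 0 (R / 2), ENNReal.ofReal A * (rieszKernel σ (z - y) * rieszKernel s y *
          (1 + ∫⁻ v, rieszKernel τ (y - v) ∂ν)) := by
          refine lintegral_mono_ae ((ae_restrict_iff' measurableSet_ball).2 ?_)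
          filter_upwards [hae] with y hy0 hy
          refine (mul_le_mul_right (hpt y ⟨hy, hy0⟩) _).trans_eq ?_
          ring
      _ ≤ ∫⁻ y in ball 0 1, ENNReal.ofReal A * (rieszKernel σ (z - y) * rieszKernel s y *
          (1 + ∫⁻ v, rieszKernel τ (y - v) ∂ν)) :=
          lintegral_mono_set (ball_subset_ball (by linarith))
      _ ≤ ENNReal.ofReal A * S := by
          rw [lintegral_const_mul' _ _ ENNReal.ofReal_ne_top]
          exact mul_le_mul_right (hSb z) _
  · calc ∫⁻ y in (ball 0 (R / 2))ᶜ, rieszKernel σ (z - y) * ENNReal.ofReal (g y)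
        ≤ ∫⁻ y in (ball 0 (R / 2))ᶜ, ENNReal.ofReal ((R / 4) ^ (-σ)) * ENNReal.ofReal (g y) := by
          refine setLIntegral_mono_ae' measurableSet_ball.compl (ae_of_all _ fun y hy => ?_)
          refine mul_le_mul_left (ENNReal.ofReal_le_ofReal ?_) _
          rw [mem_compl_iff, mem_ball_zero_iff, not_lt] at hy
          refine rpow_le_rpow_of_nonpos (by positivity) ?_ (by linarith)
          have := norm_sub_norm_le y z
          rw [norm_sub_rev]
          linarith
      _ ≤ ∫⁻ y, ENNReal.ofReal ((R / 4) ^ (-σ)) * ENNReal.ofReal (g y) :=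
          setLIntegral_le_lintegral _ _
      _ = _ := lintegral_const_mul' _ _ ENNReal.ofReal_ne_top

theorem holderOnWith_of_dist_le {X : Type*} [PseudoMetricSpace X] {f : X → ℝ} {C σ : ℝ≥0}
    {t : Set X} (h : ∀ x ∈ t, ∀ y ∈ t, |f x - f y| ≤ C * dist x y ^ (σ : ℝ)) :
    HolderOnWith C σ f t := by
  intro x hx y hy
  rw [edist_dist, edist_dist, Real.dist_eq, ENNReal.ofReal_rpow_of_nonneg dist_nonneg σ.coe_nonneg,
    ← ENNReal.ofReal_coe_nnreal, ← ENNReal.ofReal_mul C.coe_nonneg]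
  exact ENNReal.ofReal_le_ofReal (h x hx y hy)

theorem holderOnWith_logPotential {g : ℂ → ℝ} (hg : Integrable g) (hg0 : ∀ z, 0 ≤ g z)
    (hsupp : ∀ z ∉ ball (0:ℂ) (1 / 2), g z = 0) {σ : ℝ≥0} (hσ : 0 < σ) (hσ1 : σ ≤ 1) {r : ℝ}
    (hr : r ≤ 1 / 2) {S : ℝ≥0∞} (hS : S ≠ ∞)
    (h : ∀ z ∈ ball (0:ℂ) r, ∫⁻ y, rieszKernel σ (z - y) * ENNReal.ofReal (g y) ≤ S) :
    ∃ C, HolderOnWith C σ (logPotential g) (ball 0 r) := by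
  have hσ' : (0:ℝ) < σ := hσ
  have hσ1' : (σ:ℝ) ≤ 1 := hσ1
  have h0 : ∀ z v, 0 ≤ ‖z - v‖ ^ (-(σ:ℝ)) * g v := fun z v => mul_nonneg (by positivity) (hg0 v)
  have hl : ∀ z : ℂ, ∫⁻ y, rieszKernel σ (z - y) * ENNReal.ofReal (g y) =
      ∫⁻ y, ENNReal.ofReal (‖z - y‖ ^ (-(σ:ℝ)) * g y) := fun z => lintegral_congr fun y => by
    rw [rieszKernel, ENNReal.ofReal_mul (by positivity)]
  have hJ : ∀ z ∈ ball (0:ℂ) r, Integrable fun v => ‖z - v‖ ^ (-(σ:ℝ)) * g v := fun z hz =>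
    ⟨(by fun_prop : Measurable fun v : ℂ => ‖z - v‖ ^ (-(σ:ℝ))).aestronglyMeasurable.mul
      hg.aestronglyMeasurable, by
      rw [hasFiniteIntegral_iff_ofReal (ae_of_all _ (h0 z)), ← hl]
      exact (h z hz).trans_lt (lt_top_iff_ne_top.2 hS)⟩
  have hJS : ∀ z ∈ ball (0:ℂ) r, ∫ v, ‖z - v‖ ^ (-(σ:ℝ)) * g v ≤ S.toReal := by
    intro z hz
    rw [integral_eq_lintegral_of_nonneg_ae (ae_of_all _ (h0 z)) (hJ z hz).aestronglyMeasurable,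
      ← hl]
    exact ENNReal.toReal_mono hS (h z hz)
  have hk : ∀ z : ℂ, Measurable fun v : ℂ => log⁺ (1 / ‖z - v‖) := fun z => by
    simp only [posLog_def]
    exact measurable_const.max (measurable_log.comp (by fun_prop))
  have hki : ∀ z ∈ ball (0:ℂ) r, Integrable fun v => log⁺ (1 / ‖z - v‖) * g v := by
    intro z hz
    refine ((hJ z hz).const_mul (σ:ℝ)⁻¹).mono'
      ((hk z).aestronglyMeasurable.mul hg.aestronglyMeasurable) (ae_of_all _ fun v => ?_)
    rw [norm_of_nonneg (mul_nonneg posLog_nonneg (hg0 v)), ← mul_assoc]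
    exact mul_le_mul_of_nonneg_right (posLog_one_div_le_rpow (norm_nonneg _) hσ') (hg0 v)
  refine ⟨σ⁻¹ * (2 * S.toNNReal), holderOnWith_of_dist_le fun x hx y hy => ?_⟩
  have hae : ∀ z : ℂ, ∀ᵐ v : ℂ, v ≠ z := fun z => compl_mem_ae_iff.2 (measure_singleton z)
  rw [logPotential, logPotential, ← integral_sub (hki x hx) (hki y hy), ← Real.norm_eq_abs]
  have hbd := norm_integral_le_of_norm_le
    (((hJ x hx).add (hJ y hy)).const_mul ((σ:ℝ)⁻¹ * dist x y ^ (σ:ℝ)))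
    (f := fun v => log⁺ (1 / ‖x - v‖) * g v - log⁺ (1 / ‖y - v‖) * g v) (by
      filter_upwards [hae x, hae y] with v hvx hvy
      by_cases hv : v ∈ ball (0:ℂ) (1 / 2)
      · have hlt : ∀ z ∈ ball (0:ℂ) r, ‖z - v‖ ≤ 1 := fun z hz => by
          rw [mem_ball_zero_iff] at hz hv
          have := norm_sub_le z v
          linarith
        rw [posLog_one_div_of_le_one (norm_nonneg _) (hlt x hx),
          posLog_one_div_of_le_one (norm_nonneg _) (hlt y hy), ← sub_mul, norm_mul,
          Real.norm_eq_abs, norm_of_nonneg (hg0 v), Pi.add_apply, ← add_mul, ← mul_assoc]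
        refine mul_le_mul_of_nonneg_right ?_ (hg0 v)
        have h1 := abs_log_sub_log_le (norm_pos_iff.2 (sub_ne_zero.2 hvx.symm))
          (norm_pos_iff.2 (sub_ne_zero.2 hvy.symm)) hσ' hσ1'
        have h2 : |‖x - v‖ - ‖y - v‖| ≤ dist x y := by
          have := abs_norm_sub_norm_le (x - v) (y - v)
          rwa [sub_sub_sub_cancel_right, ← dist_eq_norm x y] at this
        have h3 : -log ‖x - v‖ - -log ‖y - v‖ = -(log ‖x - v‖ - log ‖y - v‖) := by ring
        rw [h3, abs_neg]
        refine h1.trans ?_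
        gcongr
      · rw [hsupp v hv, Pi.add_apply, hsupp v hv]
        simp)
  refine hbd.trans ?_
  rw [integral_const_mul, integral_add' (hJ x hx) (hJ y hy)]
  have h3 := add_le_add (hJS x hx) (hJS y hy)
  have h4 := mul_le_mul_of_nonneg_left h3
    (by positivity : 0 ≤ (σ:ℝ)⁻¹ * dist x y ^ (σ:ℝ))
  refine h4.trans_eq ?_
  push_cast
  ring

open Filter Topology in
theorem exists_setIntegral_ball_le {g : ℂ → ℝ} (hg : Integrable g) {τ : ℝ} (hτ : 0 < τ) :
    ∃ δ > 0, ∀ R ≤ δ, (∀ z, 0 ≤ g z) → ∫ z in ball 0 R, g z ≤ τ := by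
  have hanti : Antitone fun n : ℕ => ball (0:ℂ) (1 / ((n:ℝ) + 1)) := fun m n hmn =>
    ball_subset_ball (Nat.one_div_le_one_div hmn)
  have ht := tendsto_setIntegral_of_antitone (μ := volume) (f := g)
    (fun n => measurableSet_ball) hanti ⟨0, hg.integrableOn⟩
  have hI : ⋂ n : ℕ, ball (0:ℂ) (1 / ((n:ℝ) + 1)) = {0} := by
    ext z
    simp only [mem_iInter, mem_ball_zero_iff, mem_singleton_iff]
    refine ⟨fun h => ?_, fun h n => by rw [h, norm_zero]; positivity⟩
    by_contra hz
    obtain ⟨n, hn⟩ := exists_nat_one_div_lt (norm_pos_iff.2 hz)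
    exact (h n).not_gt hn
  rw [hI, setIntegral_measure_zero _ (measure_singleton 0)] at ht
  obtain ⟨n, hn⟩ := (ht.eventually (gt_mem_nhds hτ)).exists
  refine ⟨1 / ((n:ℝ) + 1), by positivity, fun R hR hg0 => le_trans ?_ hn.le⟩
  exact setIntegral_mono_set hg.integrableOn (ae_of_all _ hg0)
    (ae_of_all _ (ball_subset_ball hR))

/-- A holomorphic function is Hölder continuous near the centre of a disc, and so is its real
part. -/
theorem exists_holderOnWith_re {H : ℂ → ℂ} {R : ℝ} (hR : 0 < R)
    (hH : DifferentiableOn ℂ H (ball 0 R)) {σ : ℝ≥0} (hσ1 : σ ≤ 1) :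
    ∃ δ > 0, ∃ C, HolderOnWith C σ (fun z => (H z).re) (ball 0 δ) := by
  have hc : ContDiffAt ℂ 1 H 0 := (hH.contDiffOn isOpen_ball).contDiffAt (ball_mem_nhds 0 hR)
  obtain ⟨K, t, ht, hK⟩ := hc.exists_lipschitzOnWith
  obtain ⟨δ, hδ, hsub⟩ := Metric.mem_nhds_iff.1 ht
  refine ⟨min δ 1, lt_min hδ one_pos, ?_⟩
  have hlip : LipschitzOnWith K (fun z => (H z).re) (ball 0 (min δ 1)) := by
    refine LipschitzOnWith.of_dist_le_mul fun x hx y hy => le_trans ?_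
      (hK.dist_le_mul x (hsub (ball_subset_ball (min_le_left _ _) hx)) y
        (hsub (ball_subset_ball (min_le_left _ _) hy)))
    rw [Real.dist_eq, dist_eq_norm, ← Complex.sub_re]
    exact Complex.abs_re_le_norm _
  refine ⟨_, (holderOnWith_one.2 hlip).of_le (D := 2) (fun x hx y hy => ?_) hσ1⟩
  rw [edist_dist, ← ENNReal.ofReal_coe_nnreal]
  refine ENNReal.ofReal_le_ofReal ?_
  have hx1 := ball_subset_ball (min_le_right δ 1) hx
  have hy1 := ball_subset_ball (min_le_right δ 1) hy
  rw [mem_ball] at hx1 hy1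
  have := dist_triangle_right x y 0
  simp only [NNReal.coe_ofNat]
  linarith

open Laplacian InnerProductSpace in
theorem exists_eq_log_add_holderOnWith {w : ℂ → ℝ} {M : ℝ}
    (hw : ContDiffOn ℝ 2 w (ball 0 1 \ {0})) (h0 : ∀ z ∈ ball (0:ℂ) 1 \ {0}, 0 ≤ -(Δ w z))
    (hM : ∀ z ∈ ball (0:ℂ) 1 \ {0}, -(Δ w z) ≤ M * exp (w z))
    (hint : IntegrableOn (fun z => exp (w z)) (ball 0 1 \ {0})) :
    ∃ b : ℝ, -2 < b ∧ ∃ σ : ℝ≥0, 0 < σ ∧ σ < 1 ∧ ∃ ε > (0:ℝ), ∃ φ : ℂ → ℝ,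
      (∃ C, HolderOnWith C σ φ (ball 0 ε)) ∧
      ∀ z ∈ ball 0 ε \ {0}, w z = b * log ‖z‖ + φ z := by
  set V := ball (0:ℂ) (1 / 2) \ {0} with hV
  have hVU : V ⊆ ball (0:ℂ) 1 \ {0} := sdiff_subset_sdiff_left (ball_subset_ball (by norm_num))
  have hVm : MeasurableSet V := (isOpen_ball_diff_zero _).measurableSet
  set g := rieszDensity w with hgdef
  have hgV : ∀ z ∈ V, g z = -(Δ w z) / (2 * π) := fun z hz => indicator_of_mem hz _
  have hg0 : ∀ z, 0 ≤ g z := fun z =>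
    indicator_nonneg (fun z hz => div_nonneg (h0 z (hVU hz)) (by positivity)) z
  have hg : Integrable g := by
    refine IntegrableOn.integrable_indicator ?_ hVm
    refine ((hint.mono_set hVU).const_mul (M / (2 * π))).mono'
      ((((continuousOn_laplacian (isOpen_ball_diff_zero _) hw).mono hVU).neg.div_const
        _).aestronglyMeasurable hVm) ((ae_restrict_iff' hVm).2 (ae_of_all _ fun z hz => ?_))
    rw [norm_of_nonneg (div_nonneg (h0 z (hVU hz)) (by positivity)), div_mul_eq_mul_div]
    exact div_le_div_of_nonneg_right (hM z (hVU hz)) (by positivity)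
  have hN0 : ∀ z, 0 ≤ logPotential g z := fun z =>
    integral_nonneg fun y => mul_nonneg posLog_nonneg (hg0 y)
  have hharm := harmonicOnNhd_sub_logPotential hw hg
  rw [← hgdef] at hharm
  have hexp : IntegrableOn (fun z => exp (w z - logPotential g z)) V := by
    refine (hint.mono_set hVU).mono' ((continuous_exp.comp_continuousOn
      (HarmonicOnNhd.continuousOn hharm)).aestronglyMeasurable hVm) (ae_of_all _ fun z => ?_)
    rw [norm_of_nonneg (exp_pos _).le]
    exact exp_le_exp.2 (by linarith [hN0 z])
  obtain ⟨b, H, hH, heq⟩ := exists_eq_log_add_re_of_integrableOn_exp (by norm_num) hharm hexp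
  have h4 : (1:ℝ) / 2 / 2 = 1 / 4 := by norm_num
  rw [h4] at hH heq
  have hb : -2 < b := neg_two_lt_of_integrableOn_exp (by norm_num) hH heq
    (hexp.mono_set (sdiff_subset_sdiff_left (ball_subset_ball (by norm_num))))
  set s := max 1 (-b) with hs
  have hs1 : 1 ≤ s := le_max_left _ _
  have hsb : -b ≤ s := le_max_right _ _
  have hs2 : s < 2 := max_lt one_lt_two (by linarith)
  have hd : 0 < (2 - s) / 4 := by linarith
  set d : ℝ≥0 := ⟨(2 - s) / 4, hd.le⟩ with hdef
  have hdc : (d:ℝ) = (2 - s) / 4 := rfl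
  have hd0 : 0 < d := hd
  have hd1 : d < 1 := by
    rw [← NNReal.coe_lt_coe, hdc, NNReal.coe_one]
    linarith
  obtain ⟨δ₁, hδ₁, hm⟩ := exists_setIntegral_ball_le hg hd
  set R := min δ₁ (1 / 4) with hRdef
  have hR0 : 0 < R := lt_min hδ₁ (by norm_num)
  have hR4 : R ≤ 1 / 4 := min_le_right _ _
  obtain ⟨B, hB⟩ := (isCompact_closedBall (0:ℂ) (1 / 8)).exists_bound_of_continuousOn
    (hH.continuousOn.mono (closedBall_subset_ball (by norm_num)))
  have hgC : ∀ z ∈ ball (0:ℂ) (R / 2) \ {0},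
      g z ≤ ((|M| + 1) / (2 * π) * exp B) * ‖z‖ ^ (-s) * exp (logPotential g z) := by
    intro z hz
    have hzn : ‖z‖ < R / 2 := mem_ball_zero_iff.1 hz.1
    have hz0 : 0 < ‖z‖ := norm_pos_iff.2 hz.2
    have hzV : z ∈ V := ⟨ball_subset_ball (by linarith) hz.1, hz.2⟩
    have h1 : exp (w z) ≤ exp B * ‖z‖ ^ (-s) * exp (logPotential g z) := by
      have h2 := heq z ⟨ball_subset_ball (by linarith) hz.1, hz.2⟩
      have h3 : (H z).re ≤ B := (Complex.re_le_norm _).trans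
        (hB z (by rw [mem_closedBall_zero_iff]; linarith))
      have h5 : w z = b * log ‖z‖ + (H z).re + logPotential g z := by linarith
      have h6 : exp (b * log ‖z‖) ≤ ‖z‖ ^ (-s) := by
        rw [mul_comm, ← rpow_def_of_pos hz0]
        exact rpow_le_rpow_of_exponent_ge hz0 (by linarith) (by linarith)
      rw [h5, exp_add, exp_add, mul_comm (exp B)]
      gcongr
    have h2 := hM z (hVU hzV)
    rw [hgV z hzV]
    calc -(Δ w z) / (2 * π) ≤ (|M| + 1) * exp (w z) / (2 * π) := by
          refine div_le_div_of_nonneg_right (h2.trans ?_) (by positivity)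
          exact mul_le_mul_of_nonneg_right (by linarith [le_abs_self M]) (exp_pos _).le
      _ = (|M| + 1) / (2 * π) * exp (w z) := by ring
      _ ≤ (|M| + 1) / (2 * π) * (exp B * ‖z‖ ^ (-s) * exp (logPotential g z)) :=
          mul_le_mul_of_nonneg_left h1 (by positivity)
      _ = _ := by ring
  obtain ⟨S, hS, hSb⟩ := exists_lintegral_rieszKernel_mul_le hg hg0 (σ := d) (s := s) hd
    (by linarith) hd (by rw [hdc]; linarith) hR0 (by linarith) (by positivity)
    (hm R (min_le_left _ _) hg0) hgC
  obtain ⟨C₁, hC₁⟩ := holderOnWith_logPotential hg hg0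
    (fun z hz => indicator_of_notMem (fun h => hz h.1) _) hd0 hd1.le (by linarith) hS hSb
  obtain ⟨δ₂, hδ₂, C₂, hC₂⟩ := exists_holderOnWith_re (by norm_num) hH hd1.le
  refine ⟨b, hb, d, hd0, hd1, min (R / 4) δ₂, lt_min (by positivity) hδ₂,
    fun z => (H z).re + logPotential g z, ⟨C₁ + C₂, holderOnWith_of_dist_le fun x hx y hy => ?_⟩,
    fun z hz => ?_⟩
  · have hl := ball_subset_ball (x := (0:ℂ)) (min_le_left (R / 4) δ₂)
    have hr := ball_subset_ball (x := (0:ℂ)) (min_le_right (R / 4) δ₂)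
    have h1 := hC₁.dist_le (hl hx) (hl hy)
    have h2 := hC₂.dist_le (hr hx) (hr hy)
    rw [Real.dist_eq] at h1 h2
    have h3 := abs_add_le ((H x).re - (H y).re) (logPotential g x - logPotential g y)
    rw [add_sub_add_comm]
    push_cast
    linarith
  · have h1 := heq z ⟨ball_subset_ball ((min_le_left _ _).trans (by linarith)) hz.1, hz.2⟩
    linarith

open Laplacian in
theorem laplacian_comp_repr {n : ℕ} {E : Type*} [NormedAddCommGroup E] [InnerProductSpace ℝ E]
    [FiniteDimensional ℝ E] (v : OrthonormalBasis (Fin n) ℝ E) {f : EuclideanSpace ℝ (Fin n) → ℝ}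
    {z : E} (hf : ContDiffAt ℝ 2 f (v.repr z)) : (Δ (f ∘ v.repr)) z = lap f (v.repr z) := by
  have hd : DifferentiableAt ℝ (fderiv ℝ f) (v.repr z) :=
    (hf.fderiv_right (m := 1) (by norm_num)).differentiableAt (by norm_num)
  have hc : iteratedFDeriv ℝ 2 (f ∘ v.repr) z =
      (iteratedFDeriv ℝ 2 f (v.repr z)).compContinuousLinearMap
        fun _ => (v.repr.toContinuousLinearEquiv : E →L[ℝ] EuclideanSpace ℝ (Fin n)) := by
    have h := v.repr.toContinuousLinearEquiv.iteratedFDerivWithin_comp_right f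
      uniqueDiffOn_univ (x := z) (mem_univ _) 2
    rwa [preimage_univ, iteratedFDerivWithin_univ, iteratedFDerivWithin_univ] at h
  rw [InnerProductSpace.laplacian_eq_iteratedFDeriv_orthonormalBasis _ v]
  refine Finset.sum_congr rfl fun i _ => ?_
  rw [hc, ContinuousMultilinearMap.compContinuousLinearMap_apply, iteratedFDeriv_two_apply]
  have hi : v.repr (v i) = EuclideanSpace.single i (1:ℝ) := v.repr_self i
  have hp : fderiv ℝ (pderiv1 i f) (v.repr z) =
      (fderiv ℝ (fderiv ℝ f) (v.repr z)).flip (EuclideanSpace.single i 1) := by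
    unfold pderiv1
    rw [fderiv_clm_apply hd (differentiableAt_const _)]
    simp
  change _ = fderiv ℝ (pderiv1 i f) (v.repr z) (EuclideanSpace.single i 1)
  rw [hp]
  simp [hi]

open Laplacian in
theorem laplacian_sub_const_mul_log_norm {f : ℂ → ℝ} {z : ℂ} (hf : ContDiffAt ℝ 2 f z)
    (hz : z ≠ 0) (c : ℝ) : (Δ fun x => f x - c * log ‖x‖) z = Δ f z := by
  have h := (AnalyticAt.harmonicAt_log_norm (analyticAt_id (𝕜 := ℂ) (z := z)) hz)
  have h2 := InnerProductSpace.HarmonicAt.const_smul (c := c) h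
  have h3 := hf.laplacian_sub h2.1
  have h4 := h2.2.self_of_nhds
  rw [h4, Pi.zero_apply, sub_zero] at h3
  exact h3

theorem exp_sub_mul_log {r : ℝ} (hr : 0 < r) (a γ : ℝ) :
    exp (a - γ * log r) = r ^ (-γ) * exp a := by
  rw [rpow_def_of_pos hr, ← exp_add]
  ring_nf

/-- isolated singularity for the Gaussian curvature equation with a
singular weight, `-Δu = |x|^{-γ} K e^u` on the punctured unit disc in `ℝ²`. -/
theorem stmt_2 (γ : ℝ) (hγ : 0 < γ) (K u : EuclideanSpace ℝ (Fin 2) → ℝ)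
    (hK0 : ∀ x ∈ ball (0 : EuclideanSpace ℝ (Fin 2)) 1, 0 ≤ K x)
    (hKbdd : ∃ M : ℝ, ∀ x ∈ ball (0 : EuclideanSpace ℝ (Fin 2)) 1, K x ≤ M)
    (hu : ContDiffOn ℝ 2 u (ball (0 : EuclideanSpace ℝ (Fin 2)) 1 \ {0}))
    (heq : ∀ x ∈ ball (0 : EuclideanSpace ℝ (Fin 2)) 1 \ {0},
      -(lap u x) = ‖x‖ ^ (-γ) * K x * Real.exp (u x))
    (hint : IntegrableOn (fun x => ‖x‖ ^ (-γ) * Real.exp (u x))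
      (ball (0 : EuclideanSpace ℝ (Fin 2)) 1 \ {0})) :
    ∃ α : ℝ, α > -2 ∧ ∃ σ : NNReal, 0 < σ ∧ σ < 1 ∧
      ∃ ε > (0 : ℝ), ∃ φ : EuclideanSpace ℝ (Fin 2) → ℝ,
        (∃ C : NNReal, HolderOnWith C σ φ (ball (0 : EuclideanSpace ℝ (Fin 2)) ε)) ∧
        ∀ x ∈ ball (0 : EuclideanSpace ℝ (Fin 2)) ε \ {0},
          u x = (α + γ) * Real.log ‖x‖ + φ x := by
  obtain ⟨M, hM⟩ := hKbdd
  set L := Complex.orthonormalBasisOneI.repr with hL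
  have hpre : L ⁻¹' (ball 0 1 \ {0}) = ball 0 1 \ {0} := by
    ext z; simp
  have hmem : ∀ z ∈ ball (0:ℂ) 1 \ {0}, L z ∈ ball 0 1 \ {0} := fun z hz => by
    rw [← hpre] at hz; exact hz
  have hopen : IsOpen (ball (0 : EuclideanSpace ℝ (Fin 2)) 1 \ {0}) :=
    isOpen_ball.sdiff isClosed_singleton
  have huL : ∀ z ∈ ball (0:ℂ) 1 \ {0}, ContDiffAt ℝ 2 u (L z) := fun z hz =>
    hu.contDiffAt (hopen.mem_nhds (hmem z hz))
  have huc : ∀ z ∈ ball (0:ℂ) 1 \ {0}, ContDiffAt ℝ 2 (u ∘ L) z := fun z hz =>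
    (huL z hz).comp z L.contDiff.contDiffAt
  have hexp : ∀ z ∈ ball (0:ℂ) 1 \ {0},
      exp (u (L z) - γ * log ‖z‖) = ‖L z‖ ^ (-γ) * exp (u (L z)) := fun z hz => by
    rw [exp_sub_mul_log (norm_pos_iff.2 hz.2), L.norm_map]
  have hΔ : ∀ z ∈ ball (0:ℂ) 1 \ {0},
      -((Laplacian.laplacian fun z => u (L z) - γ * log ‖z‖) z) =
        K (L z) * exp (u (L z) - γ * log ‖z‖) := fun z hz => by
    have h := laplacian_sub_const_mul_log_norm (huc z hz) hz.2 γ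
    simp only [Function.comp_apply] at h
    rw [h, laplacian_comp_repr _ (huL z hz), heq _ (hmem z hz), hexp z hz]
    ring
  obtain ⟨b, hb, σ, hσ0, hσ1, ε, hε, φ, ⟨C, hC⟩, hφ⟩ :=
    exists_eq_log_add_holderOnWith (w := fun z => u (L z) - γ * log ‖z‖) (M := M)
      (fun z hz => ((huc z hz).sub (contDiffAt_const.mul
        ((contDiffAt_norm ℝ hz.2).log (norm_ne_zero_iff.2 hz.2)))).contDiffWithinAt)
      (fun z hz => by
        rw [hΔ z hz]; exact mul_nonneg (hK0 _ (hmem z hz).1) (exp_nonneg _))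
      (fun z hz => by
        rw [hΔ z hz]; exact mul_le_mul_of_nonneg_right (hM _ (hmem z hz).1) (exp_nonneg _))
      (by
        rw [integrableOn_congr_fun hexp (isOpen_ball_diff_zero 1).measurableSet]
        have h := (Complex.orthonormalBasisOneI.measurePreserving_repr.integrableOn_comp_preimage
          L.toHomeomorph.measurableEmbedding).2 hint
        rwa [hpre] at h)
  refine ⟨b, hb, σ, hσ0, hσ1, ε, hε, φ ∘ L.symm, ⟨C, fun x hx y hy => ?_⟩, fun x hx => ?_⟩
  · rw [← L.symm.isometry.edist_eq x y]
    exact hC _ (by simpa using hx) _ (by simpa using hy)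
  · have h := hφ (L.symm x) (by simpa using hx)
    simp only [L.apply_symm_apply, L.symm.norm_map] at h
    simp only [Function.comp_apply]
    linarith
end
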